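/- Let T be an at most countable set of vectors τ = (τ_1,…,τ_d) with 1/d ≤ τ_1 ≤ τ_2 ≤ … ≤ τ_d. For each τ let W(τ) = { (x_1,…,x_d) ∈ 𝕋^d : max_j { q^{τ_j} ‖q x_j‖ } < 1 for infinitely many q ∈ ℕ } and D(τ) = min{ (d + 1 + j τ_j − Σ_{i=1}^j τ_i)/(1 + τ_j) : 1 ≤ j ≤ d }. Then dim_H ⋂_{τ∈T} W(τ) = inf_{τ∈T} D(τ). -/

import Mathlib

open MeasureTheory Metric Filter Set
open scoped ENNReal Topology

noncomputable section

/-- The `d`-dimensional torus `ℝ^d / ℤ^d`. -/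
abbrev Torus (d : ℕ) := Fin d → AddCircle (1 : ℝ)

/-- The set `W(τ)` of points `x ∈ 𝕋^d` such that `max_j q^{τ_j} ‖q x_j‖ < 1` for
infinitely many `q ∈ ℕ`, where `‖·‖` is the distance to the nearest integer. -/
def Wset (d : ℕ) (τ : Fin d → ℝ) : Set (Torus d) :=
  {x | {q : ℕ | 0 < q ∧ ∀ i, (q : ℝ) ^ (τ i) * ‖q • x i‖ < 1}.Infinite}

/-- The dimension value
`D(τ) = min_{1 ≤ j ≤ d} (d + 1 + j τ_j - Σ_{i=1}^j τ_i) / (1 + τ_j)`. -/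
noncomputable def Dval (d : ℕ) (τ : Fin d → ℝ) : ℝ :=
  ⨅ j : Fin d,
    ((d : ℝ) + 1 + ((j : ℕ) + 1) * τ j - ∑ i ∈ Finset.univ.filter (· ≤ j), τ i) /
      (1 + τ j)

theorem sq_sum_measure_le_of_pair_bound {X : Type*} [PseudoMetricSpace X] [MeasurableSpace X]
    (μ : Measure X) [IsFiniteMeasure μ] {b s t : ℝ} (hs : 0 ≤ s) (hst : s < t) (hb0 : 0 ≤ b)
    (hb : ∀ k : ℕ, (μ.prod μ).real {p | dist p.1 p.2 ≤ (1 / 2) ^ k} ≤ b * ((1 / 2) ^ k) ^ t)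
    {ι : Type*} (I : Finset ι) (A : ι → Set X) (hA : ∀ i, MeasurableSet (A i))
    (hdisj : Pairwise (Function.onFun Disjoint A)) (ρ : ι → ℝ) (hρ0 : ∀ i, 0 < ρ i)
    (hρ1 : ∀ i, ρ i ≤ 1) (hd : ∀ i, ∀ x ∈ A i, ∀ y ∈ A i, dist x y ≤ ρ i) :
    (∑ i ∈ I, μ.real (A i)) ^ 2 ≤
      (∑ i ∈ I, ρ i ^ s) * (b * 2 ^ s * (1 - (1 / 2) ^ (t - s))⁻¹) := by
  have hex : ∀ i, ∃ n : ℕ, (1 / 2 : ℝ) ^ (n + 1) < ρ i ∧ ρ i ≤ (1 / 2) ^ n := fun i =>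
    exists_nat_pow_near_of_lt_one (hρ0 i) (hρ1 i) (by norm_num) (by norm_num)
  choose k hk1 hk2 using hex
  have hρs : ∀ i, 0 < ρ i ^ s := fun i => Real.rpow_pos_of_pos (hρ0 i) s
  have hCS : (∑ i ∈ I, μ.real (A i)) ^ 2 ≤
      (∑ i ∈ I, ρ i ^ s) * ∑ i ∈ I, μ.real (A i) ^ 2 / ρ i ^ s := by
    rcases I.eq_empty_or_nonempty with rfl | hI
    · simp
    · have h := Finset.sq_sum_div_le_sum_sq_div I (fun i => μ.real (A i)) (g := fun i => ρ i ^ s)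
        (fun i _ => hρs i)
      rw [div_le_iff₀ (Finset.sum_pos (fun i _ => hρs i) hI)] at h
      linarith
  refine hCS.trans (mul_le_mul_of_nonneg_left ?_ (Finset.sum_nonneg fun i _ => (hρs i).le))
  have hinv : ∀ i, (ρ i ^ s)⁻¹ ≤ 2 ^ s * (((1 / 2 : ℝ) ^ (k i)) ^ s)⁻¹ := by
    intro i
    have h1 : (1 / 2 : ℝ) ^ s * ((1 / 2 : ℝ) ^ (k i)) ^ s ≤ ρ i ^ s := by
      rw [← Real.mul_rpow (by norm_num) (by positivity)]
      apply Real.rpow_le_rpow (by positivity) _ hs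
      have := hk1 i
      rw [pow_succ] at this
      linarith
    have h2 : (2 : ℝ) ^ s = ((1 / 2 : ℝ) ^ s)⁻¹ := by
      rw [← Real.inv_rpow (by norm_num)]; norm_num
    rw [h2, ← mul_inv]
    exact inv_anti₀ (by positivity) h1
  set N := I.sup k + 1 with hN
  have hkN : ∀ i ∈ I, k i ∈ Finset.range N := fun i hi =>
    Finset.mem_range.2 (Nat.lt_succ_of_le (Finset.le_sup hi))
  have hlevel : ∀ n : ℕ, ∑ i ∈ I with k i = n, μ.real (A i) ^ 2 ≤ b * ((1 / 2) ^ n) ^ t := by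
    intro n
    refine le_trans ?_ (hb n)
    have hprod : ∀ i, μ.real (A i) ^ 2 = (μ.prod μ).real (A i ×ˢ A i) := by
      intro i
      rw [measureReal_prod_prod, sq]
    simp_rw [hprod]
    rw [← measureReal_biUnion_finset]
    · refine measureReal_mono ?_ (measure_ne_top _ _)
      intro p hp
      simp only [Set.mem_iUnion, Finset.mem_filter] at hp
      obtain ⟨i, ⟨hi, hin⟩, h1, h2⟩ := hp
      exact ((hd i _ h1 _ h2).trans (hk2 i)).trans_eq (by rw [hin])
    · intro i _ j _ hij
      exact Set.disjoint_prod.2 (Or.inl (hdisj hij))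
    · exact fun i _ => (hA i).prod (hA i)
  have hgeo : (1 / 2 : ℝ) ^ (t - s) < 1 :=
    Real.rpow_lt_one (by norm_num) (by norm_num) (by linarith)
  calc ∑ i ∈ I, μ.real (A i) ^ 2 / ρ i ^ s
      ≤ ∑ i ∈ I, 2 ^ s * (((1 / 2 : ℝ) ^ (k i)) ^ s)⁻¹ * μ.real (A i) ^ 2 := by
        refine Finset.sum_le_sum fun i _ => ?_
        rw [div_eq_mul_inv, mul_comm]
        exact mul_le_mul_of_nonneg_right (hinv i) (sq_nonneg _)
    _ = ∑ n ∈ Finset.range N, ∑ i ∈ I with k i = n,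
          2 ^ s * (((1 / 2 : ℝ) ^ (k i)) ^ s)⁻¹ * μ.real (A i) ^ 2 :=
        (Finset.sum_fiberwise_of_maps_to hkN _).symm
    _ = ∑ n ∈ Finset.range N, 2 ^ s * (((1 / 2 : ℝ) ^ n) ^ s)⁻¹ *
          ∑ i ∈ I with k i = n, μ.real (A i) ^ 2 := by
        refine Finset.sum_congr rfl fun n _ => ?_
        rw [Finset.mul_sum]
        refine Finset.sum_congr rfl fun i hi => ?_
        rw [(Finset.mem_filter.1 hi).2]
    _ ≤ ∑ n ∈ Finset.range N, b * 2 ^ s * ((1 / 2 : ℝ) ^ (t - s)) ^ n := by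
        refine Finset.sum_le_sum fun n _ => ?_
        have hpow : ((1 / 2 : ℝ) ^ (t - s)) ^ n = (((1 / 2 : ℝ) ^ n) ^ s)⁻¹ * ((1 / 2) ^ n) ^ t := by
          rw [← Real.rpow_neg (by positivity), ← Real.rpow_add (by positivity),
            ← Real.rpow_natCast_mul (by norm_num), ← Real.rpow_mul_natCast (by norm_num)]
          ring_nf
        rw [hpow]
        calc 2 ^ s * (((1 / 2 : ℝ) ^ n) ^ s)⁻¹ * ∑ i ∈ I with k i = n, μ.real (A i) ^ 2
            ≤ 2 ^ s * (((1 / 2 : ℝ) ^ n) ^ s)⁻¹ * (b * ((1 / 2) ^ n) ^ t) :=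
              mul_le_mul_of_nonneg_left (hlevel n) (by positivity)
          _ = _ := by ring
    _ ≤ b * 2 ^ s * (1 - (1 / 2) ^ (t - s))⁻¹ := by
        rw [← Finset.mul_sum]
        refine mul_le_mul_of_nonneg_left ?_ (by positivity)
        rw [← tsum_geometric_of_lt_one (by positivity) hgeo]
        exact (summable_geometric_of_lt_one (by positivity) hgeo).sum_le_tsum _
          (fun _ _ => by positivity)

theorem exists_isOpen_superset_dist_le {X : Type*} [PseudoMetricSpace X] {s : ℝ} (hs : 0 < s)
    (A : Set X) (hA : ediam A ≤ 1 / 2) {ε : ℝ≥0∞} (hε : 0 < ε) :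
    ∃ (U : Set X) (ρ : ℝ), IsOpen U ∧ A ⊆ U ∧ 0 < ρ ∧ ρ ≤ 1 ∧
      (∀ x ∈ U, ∀ y ∈ U, dist x y ≤ ρ) ∧ ENNReal.ofReal (ρ ^ s) ≤ ediam A ^ s + ε := by
  have hfin : ediam A ≠ ⊤ := (hA.trans_lt (by norm_num)).ne
  have hlt : ediam A < 1 := hA.trans_lt (by norm_num)
  have hcont : Tendsto (fun e : ℝ≥0∞ => e ^ s) (𝓝 (ediam A)) (𝓝 (ediam A ^ s)) :=
    (ENNReal.continuous_rpow_const).tendsto _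
  have hpow : ediam A ^ s < ediam A ^ s + ε :=
    ENNReal.lt_add_right (ENNReal.rpow_ne_top_of_nonneg hs.le hfin) hε.ne'
  obtain ⟨u, hu, hu'⟩ := exists_Ico_subset_of_mem_nhds (hcont.eventually (gt_mem_nhds hpow))
    ⟨1, hlt⟩
  obtain ⟨e, he1, he2⟩ := exists_between (lt_min hu hlt)
  have he3 : e ^ s < ediam A ^ s + ε := hu' ⟨he1.le, he2.trans_le (min_le_left _ _)⟩
  have heone : e < 1 := he2.trans_le (min_le_right _ _)
  have hetop : e ≠ ⊤ := (heone.trans ENNReal.one_lt_top).ne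
  have hr : 0 < (e.toReal - (ediam A).toReal) / 2 := by
    have := (ENNReal.toReal_lt_toReal hfin hetop).2 he1
    linarith
  refine ⟨thickening ((e.toReal - (ediam A).toReal) / 2) A, e.toReal, isOpen_thickening,
    self_subset_thickening hr A, ENNReal.toReal_pos (pos_of_gt he1).ne' hetop, ?_, ?_, ?_⟩
  · exact ENNReal.toReal_le_of_le_ofReal zero_le_one (by simpa using heone.le)
  · intro x hx y hy
    obtain ⟨x', hx', hxx⟩ := mem_thickening_iff.1 hx
    obtain ⟨y', hy', hyy⟩ := mem_thickening_iff.1 hy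
    have h1 : dist x' y' ≤ (ediam A).toReal := by
      rw [dist_edist]
      exact (ENNReal.toReal_le_toReal (edist_ne_top _ _) hfin).2 (edist_le_ediam_of_mem hx' hy')
    have h2 := dist_triangle4 x x' y' y
    rw [dist_comm y' y] at h2
    linarith
  · rw [← ENNReal.ofReal_rpow_of_pos (ENNReal.toReal_pos (pos_of_gt he1).ne' hetop),
      ENNReal.ofReal_toReal hetop]
    exact he3.le

theorem hausdorffMeasure_iInter_ne_zero {X : Type*} [MetricSpace X] [MeasurableSpace X]
    [BorelSpace X] {K : ℕ → Set X} (hKanti : Antitone K) (hK : ∀ n, IsCompact (K n))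
    (μ : ℕ → Measure X) [∀ n, IsFiniteMeasure (μ n)] (hμK : ∀ n, μ n (K n)ᶜ = 0)
    {a b s t : ℝ} (ha : 0 < a) (hmass : ∀ n, a ≤ (μ n).real univ) (hb0 : 0 ≤ b)
    (hs : 0 < s) (hst : s < t)
    (hb : ∀ n, ∀ k : ℕ, ((μ n).prod (μ n)).real {p | dist p.1 p.2 ≤ (1 / 2) ^ k} ≤
      b * ((1 / 2) ^ k) ^ t) :
    μH[s] (⋂ n, K n) ≠ 0 := by
  intro hzero
  set C : ℝ := b * 2 ^ s * (1 - (1 / 2) ^ (t - s))⁻¹ with hC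
  have hC0 : 0 ≤ C := by
    have hgeo : (1 / 2 : ℝ) ^ (t - s) < 1 :=
      Real.rpow_lt_one (by norm_num) (by norm_num) (by linarith)
    have : 0 < 1 - (1 / 2 : ℝ) ^ (t - s) := by linarith
    positivity
  set c : ℝ := a ^ 2 / (2 * (C + 1)) with hc
  have hc0 : 0 < c := by positivity
  rw [Measure.hausdorffMeasure_apply] at hzero
  simp only [ENNReal.iSup_eq_zero] at hzero
  have hz := hzero (1 / 2) (by norm_num)
  have hlt : (0 : ℝ≥0∞) < ENNReal.ofReal (c / 2) := ENNReal.ofReal_pos.2 (by positivity)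
  rw [← hz] at hlt
  simp only [iInf_lt_iff] at hlt
  obtain ⟨A, hcov, hdiam, hsum⟩ := hlt
  obtain ⟨ε, hε0, hεsum⟩ := ENNReal.exists_pos_sum_of_countable
    (ENNReal.ofReal_pos.2 (half_pos hc0)).ne' ℕ
  choose U ρ hUo hAU hρ0 hρ1 hUd hρs using fun n =>
    exists_isOpen_superset_dist_le hs (A n) (hdiam n) (ε := ε n) (by exact_mod_cast hε0 n)
  obtain ⟨N, hN⟩ : ∃ N, K N ⊆ ⋃ n, U n := by
    refine exists_subset_nhds_of_isCompact hKanti.directed_ge hK fun x hx => ?_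
    obtain ⟨n, hn⟩ := mem_iUnion.1 (hcov hx)
    exact (isOpen_iUnion hUo).mem_nhds (mem_iUnion.2 ⟨n, hAU n hn⟩)
  obtain ⟨I, hI⟩ := (hK N).elim_finite_subcover U hUo hN
  obtain ⟨M, hM⟩ : ∃ M, I ⊆ Finset.range M := ⟨I.sup id + 1, fun i hi =>
    Finset.mem_range.2 (Nat.lt_succ_of_le (Finset.le_sup (f := id) hi))⟩
  have hdis : ∀ n, disjointed U n ⊆ U n := fun n => disjointed_subset U n
  have hmeas : ∀ n, MeasurableSet (disjointed U n) :=
    fun n => MeasurableSet.disjointed (fun i => (hUo i).measurableSet) n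
  have hcover : K N ⊆ ⋃ i ∈ Finset.range M, disjointed U i := by
    intro x hx
    obtain ⟨i, hi, hxi⟩ := mem_iUnion₂.1 (hI hx)
    have h1 : x ∈ partialSups U i := le_partialSups U i hxi
    rw [← partialSups_disjointed, partialSups_eq_biUnion_range] at h1
    obtain ⟨j, hj, hxj⟩ := mem_iUnion₂.1 h1
    refine mem_iUnion₂.2 ⟨j, ?_, hxj⟩
    have := Finset.mem_range.1 (hM hi)
    have := Finset.mem_range.1 hj
    exact Finset.mem_range.2 (by omega)
  have hmassN : a ≤ ∑ i ∈ Finset.range M, (μ N).real (disjointed U i) := by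
    refine (hmass N).trans ?_
    have h1 : (μ N).real univ = (μ N).real (K N) := by
      rw [measureReal_def, measureReal_def,
        ← measure_add_measure_compl (hK N).isClosed.measurableSet, hμK N, add_zero]
    rw [h1]
    exact (measureReal_mono hcover (measure_ne_top _ _)).trans (measureReal_biUnion_finset_le _ _)
  have hkey := sq_sum_measure_le_of_pair_bound (μ N) hs.le hst hb0 (hb N) (Finset.range M)
    (disjointed U) hmeas (disjoint_disjointed U) ρ hρ0 hρ1
    (fun i x hx y hy => hUd i x (hdis i hx) y (hdis i hy))
  have hρsum : ∑ i ∈ Finset.range M, ρ i ^ s ≤ c := by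
    have h1 : ENNReal.ofReal (∑ i ∈ Finset.range M, ρ i ^ s) ≤ ENNReal.ofReal c := by
      rw [ENNReal.ofReal_sum_of_nonneg (fun i _ => (Real.rpow_pos_of_pos (hρ0 i) s).le)]
      calc ∑ i ∈ Finset.range M, ENNReal.ofReal (ρ i ^ s)
          ≤ ∑' i, ENNReal.ofReal (ρ i ^ s) := ENNReal.sum_le_tsum _
        _ ≤ ∑' i, ((⨆ _ : (A i).Nonempty, ediam (A i) ^ s) + ε i) := by
            refine ENNReal.tsum_le_tsum fun i => (hρs i).trans (add_le_add_left ?_ _)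
            rcases (A i).eq_empty_or_nonempty with h | h
            · simp [h, hs]
            · simp [h]
        _ = (∑' i, ⨆ _ : (A i).Nonempty, ediam (A i) ^ s) + ∑' i, (ε i : ℝ≥0∞) :=
            ENNReal.tsum_add
        _ ≤ ENNReal.ofReal (c / 2) + ENNReal.ofReal (c / 2) := add_le_add hsum.le hεsum.le
        _ = ENNReal.ofReal c := by
            rw [← ENNReal.ofReal_add (by positivity) (by positivity), add_halves]
    exact (ENNReal.ofReal_le_ofReal_iff hc0.le).1 h1
  have h3 : a ^ 2 ≤ c * C := by
    calc a ^ 2 ≤ (∑ i ∈ Finset.range M, (μ N).real (disjointed U i)) ^ 2 :=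
          pow_le_pow_left₀ ha.le hmassN 2
      _ ≤ _ := hkey
      _ ≤ c * C := mul_le_mul_of_nonneg_right hρsum hC0
  rw [hc, div_mul_eq_mul_div, le_div_iff₀ (by positivity)] at h3
  nlinarith [sq_nonneg a, mul_nonneg (sq_nonneg a) hC0, pow_pos ha 2]

/-- A probability measure on a set `S` is approximated by probability measures with continuous
densities carried by closed subsets of `S`, with uniformly controlled correlation `C * r ^ t`. -/
def FrostmanDense {X : Type*} [MetricSpace X] [MeasurableSpace X] [BorelSpace X]
    (P : ProbabilityMeasure X) (t : ℝ) (S : Set X) : Prop :=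
  ∃ (C : ℝ) (ν : ℕ → ProbabilityMeasure X) (g : ℕ → X → NNReal),
    (∀ n, Continuous (g n)) ∧
    (∀ n, (ν n : Measure X) = (P : Measure X).withDensity fun x => (g n x : ℝ≥0∞)) ∧
    (∀ n, ∃ F, IsClosed F ∧ F ⊆ S ∧ ∀ x ∉ F, g n x = 0) ∧
    Tendsto ν atTop (𝓝 P) ∧
    ∀ᶠ n in atTop, ∀ r : ℝ, 0 < r → r ≤ 2 →
      ((ν n : Measure X).prod (ν n)) {p | dist p.1 p.2 ≤ r} ≤ ENNReal.ofReal (C * r ^ t)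

/-- A continuous approximation of the indicator of `{p | dist p.1 p.2 ≤ 2 ^ (-k)}`. -/
def nearDiag {X : Type*} [MetricSpace X] (k : ℕ) (p : X × X) : NNReal :=
  Real.toNNReal (min 1 (2 - 2 ^ k * dist p.1 p.2))

theorem continuous_nearDiag {X : Type*} [MetricSpace X] (k : ℕ) :
    Continuous (nearDiag k : X × X → NNReal) := by
  unfold nearDiag; fun_prop

theorem nearDiag_le_one {X : Type*} [MetricSpace X] (k : ℕ) (p : X × X) : nearDiag k p ≤ 1 := by
  unfold nearDiag
  exact Real.toNNReal_le_one.2 (min_le_left _ _)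

theorem nearDiag_eq_one {X : Type*} [MetricSpace X] {k : ℕ} {p : X × X}
    (h : dist p.1 p.2 ≤ (1 / 2) ^ k) : nearDiag k p = 1 := by
  unfold nearDiag
  rw [min_eq_left, Real.toNNReal_one]
  have : (2 : ℝ) ^ k * dist p.1 p.2 ≤ 2 ^ k * (1 / 2) ^ k := by gcongr
  rw [← mul_pow] at this
  norm_num at this
  linarith

theorem nearDiag_eq_zero {X : Type*} [MetricSpace X] {k : ℕ} {p : X × X}
    (h : 2 * (1 / 2) ^ k < dist p.1 p.2) : nearDiag k p = 0 := by
  unfold nearDiag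
  refine Real.toNNReal_of_nonpos ((min_le_right _ _).trans ?_)
  have : (2 : ℝ) ^ k * (2 * (1 / 2) ^ k) ≤ 2 ^ k * dist p.1 p.2 := by gcongr
  have h2 : (2 : ℝ) ^ k * (2 * (1 / 2) ^ k) = 2 := by
    rw [mul_left_comm, ← mul_pow]; norm_num
  linarith

theorem tendsto_lintegral_of_continuous_of_le {Ω : Type*} [TopologicalSpace Ω] [MeasurableSpace Ω]
    [OpensMeasurableSpace Ω] {μs : ℕ → ProbabilityMeasure Ω} {μ : ProbabilityMeasure Ω}
    (h : Tendsto μs atTop (𝓝 μ)) {f : Ω → NNReal} (hf : Continuous f) {M : NNReal}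
    (hM : ∀ x, f x ≤ M) :
    Tendsto (fun n => ∫⁻ x, f x ∂(μs n : Measure Ω)) atTop (𝓝 (∫⁻ x, f x ∂(μ : Measure Ω))) := by
  have := ProbabilityMeasure.tendsto_iff_forall_lintegral_tendsto.1 h
    (BoundedContinuousFunction.mkOfBound ⟨f, hf⟩ M fun x y => by
      rw [NNReal.dist_eq, abs_le]
      have hx : (f x : ℝ) ≤ M := hM x
      have hy : (f y : ℝ) ≤ M := hM y
      have := (f x).coe_nonneg
      have := (f y).coe_nonneg
      constructor <;> simp only [ContinuousMap.coe_mk] <;> linarith)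
  exact this

theorem exists_forall_le_of_eq_zero_off {X : Type*} [TopologicalSpace X] {K : Set X}
    (hK : IsCompact K) {f : X → NNReal} (hf : Continuous f) (h0 : ∀ x ∉ K, f x = 0) :
    ∃ M, ∀ x, f x ≤ M := by
  obtain ⟨M, hM⟩ := hK.bddAbove_image hf.continuousOn
  refine ⟨M, fun x => ?_⟩
  by_cases hx : x ∈ K
  · exact hM (mem_image_of_mem f hx)
  · rw [h0 x hx]; exact zero_le

theorem eventually_ofReal_mul_two_pow_rpow_lt {D t t' : ℝ} (htt : t' < t) {b : ℝ≥0∞}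
    (hb : 0 < b) (hbt : b ≠ ∞) :
    ∀ᶠ k : ℕ in atTop, ENNReal.ofReal (D * (2 * (1 / 2) ^ k) ^ t) <
      b * ENNReal.ofReal (((1 / 2) ^ k) ^ t') := by
  have hlim : Tendsto (fun k : ℕ => D * 2 ^ t * ((1 / 2 : ℝ) ^ (t - t')) ^ k) atTop (𝓝 0) := by
    rw [← mul_zero (D * 2 ^ t)]
    exact (tendsto_pow_atTop_nhds_zero_of_lt_one (by positivity)
      (Real.rpow_lt_one (by norm_num) (by norm_num) (by linarith))).const_mul _
  have hb' : 0 < b.toReal := ENNReal.toReal_pos hb.ne' hbt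
  filter_upwards [hlim.eventually (gt_mem_nhds hb')] with k hk
  rw [← ENNReal.ofReal_toReal hbt, ← ENNReal.ofReal_mul hb'.le]
  have hpos : 0 < ((1 / 2 : ℝ) ^ k) ^ t' := by positivity
  refine (ENNReal.ofReal_lt_ofReal_iff (by positivity)).2 ?_
  have hpow : (2 * (1 / 2 : ℝ) ^ k) ^ t =
      2 ^ t * ((1 / 2 : ℝ) ^ (t - t')) ^ k * ((1 / 2) ^ k) ^ t' := by
    rw [Real.mul_rpow (by norm_num) (by positivity), mul_assoc]
    congr 1
    rw [← Real.rpow_natCast_mul (by norm_num), ← Real.rpow_mul_natCast (by norm_num),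
      ← Real.rpow_natCast_mul (by norm_num), ← Real.rpow_add (by norm_num)]
    ring_nf
  rw [hpow]
  calc D * (2 ^ t * ((1 / 2 : ℝ) ^ (t - t')) ^ k * ((1 / 2) ^ k) ^ t')
      = D * 2 ^ t * ((1 / 2 : ℝ) ^ (t - t')) ^ k * ((1 / 2) ^ k) ^ t' := by ring
    _ < _ := mul_lt_mul_of_pos_right hk hpos

section

variable {X : Type*} [MetricSpace X] [MeasurableSpace X] [BorelSpace X]

/-- The mollified mass that `f • P ⊗ f • P` gives to the `2 ^ (-k)`-neighbourhood of the
diagonal. -/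
def pairEnergy (P : ProbabilityMeasure X) (k : ℕ) (f : X → NNReal) : ℝ≥0∞ :=
  ∫⁻ p, ((f p.1 * f p.2 * nearDiag k p : NNReal) : ℝ≥0∞) ∂((P : Measure X).prod P)

variable [SecondCountableTopology X]

theorem pairEnergy_mul (P : ProbabilityMeasure X) (k : ℕ) {f g : X → NNReal} (hf : Continuous f)
    (hg : Continuous g) (Q : ProbabilityMeasure X)
    (hQ : (Q : Measure X) = (P : Measure X).withDensity fun x => (g x : ℝ≥0∞)) :
    pairEnergy P k (fun x => f x * g x) =
      ∫⁻ p, ((f p.1 * f p.2 * nearDiag k p : NNReal) : ℝ≥0∞) ∂((Q : Measure X).prod Q) := by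
  have hgm : Measurable fun x => (g x : ℝ≥0∞) := hg.measurable.coe_nnreal_ennreal
  have hk := continuous_nearDiag (X := X) k
  have : SFinite ((P : Measure X).withDensity fun x => (g x : ℝ≥0∞)) := by
    rw [← hQ]; infer_instance
  rw [hQ, prod_withDensity hgm hgm, lintegral_withDensity_eq_lintegral_mul _ (by fun_prop)
    (Continuous.measurable (by fun_prop)).coe_nnreal_ennreal]
  unfold pairEnergy
  refine lintegral_congr fun p => ?_
  simp only [Pi.mul_apply]
  push_cast
  ring

theorem pairEnergy_mul_le (P : ProbabilityMeasure X) (k : ℕ) {f g : X → NNReal} (hf : Continuous f)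
    (hg : Continuous g) (Q : ProbabilityMeasure X)
    (hQ : (Q : Measure X) = (P : Measure X).withDensity fun x => (g x : ℝ≥0∞)) {M : NNReal}
    (hM : ∀ x, f x ≤ M) :
    pairEnergy P k (fun x => f x * g x) ≤
      M ^ 2 * ((Q : Measure X).prod Q) {p | dist p.1 p.2 ≤ 2 * (1 / 2) ^ k} := by
  rw [pairEnergy_mul P k hf hg Q hQ]
  have hms : MeasurableSet {p : X × X | dist p.1 p.2 ≤ 2 * (1 / 2) ^ k} :=
    (isClosed_le (by fun_prop) (by fun_prop)).measurableSet
  calc _ ≤ ∫⁻ p, {p : X × X | dist p.1 p.2 ≤ 2 * (1 / 2) ^ k}.indicator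
            (fun _ => ((M ^ 2 : NNReal) : ℝ≥0∞)) p ∂((Q : Measure X).prod Q) := by
        refine lintegral_mono fun p => ?_
        by_cases hp : dist p.1 p.2 ≤ 2 * (1 / 2) ^ k
        · rw [indicator_of_mem (by exact hp)]
          refine ENNReal.coe_le_coe.2 ?_
          calc f p.1 * f p.2 * nearDiag k p ≤ M * M * 1 := by
                gcongr
                exacts [hM _, hM _, nearDiag_le_one k p]
            _ = M ^ 2 := by ring
        · rw [nearDiag_eq_zero (not_le.1 hp)]
          simp
    _ = _ := by
        rw [lintegral_indicator_const hms]
        push_cast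
        rfl

theorem tendsto_pairEnergy (P : ProbabilityMeasure X) (k : ℕ) {f : X → NNReal} (hf : Continuous f)
    {M : NNReal} (hM : ∀ x, f x ≤ M) {ν : ℕ → ProbabilityMeasure X} {g : ℕ → X → NNReal}
    (hg : ∀ n, Continuous (g n))
    (hν : ∀ n, (ν n : Measure X) = (P : Measure X).withDensity fun x => (g n x : ℝ≥0∞))
    (hlim : Tendsto ν atTop (𝓝 P)) :
    Tendsto (fun n => pairEnergy P k fun x => f x * g n x) atTop (𝓝 (pairEnergy P k f)) := by
  have hprod : Tendsto (fun n => (ν n).prod (ν n)) atTop (𝓝 (P.prod P)) :=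
    (ProbabilityMeasure.continuous_prod.tendsto (P, P)).comp (hlim.prodMk_nhds hlim)
  have hk := continuous_nearDiag (X := X) k
  have := tendsto_lintegral_of_continuous_of_le hprod
    (f := fun p => f p.1 * f p.2 * nearDiag k p) (M := M * M * 1) (by fun_prop) (fun p => by
      gcongr
      exacts [hM _, hM _, nearDiag_le_one k p])
  exact this.congr fun n => (pairEnergy_mul P k hf (hg n) (ν n) (hν n)).symm

/-- The properties preserved along the construction. -/
structure Admissible (P : ProbabilityMeasure X) (a b : ℝ≥0∞) (t : ℝ) (K : Set X)
    (f : X → NNReal) : Prop where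
  isCompact : IsCompact K
  continuous : Continuous f
  eq_zero : ∀ x ∉ K, f x = 0
  mass : a < ∫⁻ x, f x ∂(P : Measure X)
  energy : ∀ k, pairEnergy P k f < b * ENNReal.ofReal (((1 / 2) ^ k) ^ t)

theorem Admissible.exists_subset {P : ProbabilityMeasure X} {a b : ℝ≥0∞} {t t' : ℝ} {K : Set X}
    {f : X → NNReal} (h : Admissible P a b t' K f) (htt : t' < t) (hb : 0 < b) (hbt : b ≠ ∞)
    {S : Set X} (hS : FrostmanDense P t S) :
    ∃ K' f', Admissible P a b t' K' f' ∧ K' ⊆ K ∩ S := by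
  obtain ⟨C, ν, g, hg, hν, hF, hlim, hC⟩ := hS
  obtain ⟨M, hM⟩ := exists_forall_le_of_eq_zero_off h.isCompact h.continuous h.eq_zero
  have hmass : ∀ᶠ n in atTop, a < ∫⁻ x, ((f x * g n x : NNReal) : ℝ≥0∞) ∂(P : Measure X) := by
    have h1 := tendsto_lintegral_of_continuous_of_le hlim h.continuous hM
    filter_upwards [h1.eventually (lt_mem_nhds h.mass)] with n hn
    rw [hν n, lintegral_withDensity_eq_lintegral_mul _ (hg n).measurable.coe_nnreal_ennreal
      h.continuous.measurable.coe_nnreal_ennreal] at hn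
    refine hn.trans_eq (lintegral_congr fun x => ?_)
    simp only [Pi.mul_apply]
    push_cast
    ring
  obtain ⟨k₀, hk₀⟩ := eventually_atTop.1
    (eventually_ofReal_mul_two_pow_rpow_lt (D := M ^ 2 * C) htt hb hbt)
  have hsmall : ∀ᶠ n in atTop, ∀ k ∈ Finset.range k₀, pairEnergy P k (fun x => f x * g n x) <
      b * ENNReal.ofReal (((1 / 2) ^ k) ^ t') :=
    (Finset.eventually_all _).2 fun k _ =>
      (tendsto_pairEnergy P k h.continuous hM hg hν hlim).eventually (gt_mem_nhds (h.energy k))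
  obtain ⟨n, hn1, hn2, hn3⟩ := (hmass.and (hsmall.and hC)).exists
  obtain ⟨F, hFc, hFS, hF0⟩ := hF n
  refine ⟨K ∩ F, fun x => f x * g n x, ⟨h.isCompact.inter_right hFc, h.continuous.mul (hg n), ?_,
    hn1, fun k => ?_⟩, inter_subset_inter_right K hFS⟩
  · intro x hx
    by_cases hxK : x ∈ K
    · rw [hF0 x fun hxF => hx ⟨hxK, hxF⟩, mul_zero]
    · rw [h.eq_zero x hxK, zero_mul]
  · rcases lt_or_ge k k₀ with hk | hk
    · exact hn2 k (Finset.mem_range.2 hk)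
    · refine (pairEnergy_mul_le P k h.continuous (hg n) (ν n) (hν n) hM).trans_lt
        (lt_of_le_of_lt ?_ (hk₀ k hk))
      rw [mul_assoc, ENNReal.ofReal_mul (by positivity)]
      refine mul_le_mul' ?_ (hn3 _ (by positivity) ?_)
      · rw [ENNReal.ofReal_pow (by positivity), ENNReal.ofReal_coe_nnreal]
      · have : (1 / 2 : ℝ) ^ k ≤ 1 := pow_le_one₀ (by norm_num) (by norm_num)
        linarith

theorem exists_admissible {P : ProbabilityMeasure X} {t t' : ℝ} {K : Set X} {f : X → NNReal}
    (hK : IsCompact K) (hf : Continuous f) (hf0 : ∀ x ∉ K, f x = 0)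
    (hpos : 0 < ∫⁻ x, f x ∂(P : Measure X)) (htt : t' < t)
    {S : Set X} (hS : FrostmanDense P t S) :
    ∃ a b, 0 < a ∧ 0 < b ∧ b ≠ ∞ ∧ Admissible P a b t' K f := by
  obtain ⟨C, ν, g, hg, hν, -, hlim, hC⟩ := hS
  obtain ⟨M, hM⟩ := exists_forall_le_of_eq_zero_off hK hf hf0
  obtain ⟨a, ha0, ha⟩ := exists_between hpos
  have hE : ∀ k, pairEnergy P k f ≤ M ^ 2 * ENNReal.ofReal (C * (2 * (1 / 2) ^ k) ^ t) := by
    intro k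
    refine le_of_tendsto (tendsto_pairEnergy P k hf hM hg hν hlim) ?_
    filter_upwards [hC] with n hn
    refine (pairEnergy_mul_le P k hf (hg n) (ν n) (hν n) hM).trans (mul_le_mul' le_rfl ?_)
    refine hn _ (by positivity) ?_
    have : (1 / 2 : ℝ) ^ k ≤ 1 := pow_le_one₀ (by norm_num) (by norm_num)
    linarith
  refine ⟨a, ENNReal.ofReal (M ^ 2 * |C| * 2 ^ t + 1), ha0, by
    rw [ENNReal.ofReal_pos]; positivity, ENNReal.ofReal_ne_top, hK, hf, hf0, ha, fun k => ?_⟩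
  refine (hE k).trans_lt ?_
  rw [← ENNReal.ofReal_coe_nnreal, ← ENNReal.ofReal_pow (by positivity),
    ← ENNReal.ofReal_mul (by positivity), ← ENNReal.ofReal_mul (by positivity)]
  have hpos : 0 < ((1 / 2 : ℝ) ^ k) ^ t' := by positivity
  refine (ENNReal.ofReal_lt_ofReal_iff (by positivity)).2 ?_
  have h1 : ((1 / 2 : ℝ) ^ k) ^ t ≤ ((1 / 2 : ℝ) ^ k) ^ t' :=
    Real.rpow_le_rpow_of_exponent_ge (by positivity) (pow_le_one₀ (by norm_num) (by norm_num))
      htt.le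
  rw [Real.mul_rpow (by norm_num) (by positivity)]
  calc (M : ℝ) ^ 2 * (C * (2 ^ t * ((1 / 2 : ℝ) ^ k) ^ t))
      ≤ (M : ℝ) ^ 2 * (|C| * (2 ^ t * ((1 / 2 : ℝ) ^ k) ^ t')) := by
        gcongr
        exact le_abs_self C
    _ = M ^ 2 * |C| * 2 ^ t * ((1 / 2 : ℝ) ^ k) ^ t' := by ring
    _ < _ := by linarith

theorem pair_measure_le_pairEnergy (P : ProbabilityMeasure X) (k : ℕ) {f : X → NNReal}
    (hf : Continuous f) :
    (((P : Measure X).withDensity fun x => (f x : ℝ≥0∞)).prod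
      ((P : Measure X).withDensity fun x => (f x : ℝ≥0∞))) {p | dist p.1 p.2 ≤ (1 / 2) ^ k} ≤
      pairEnergy P k f := by
  have hfm : Measurable fun x => (f x : ℝ≥0∞) := hf.measurable.coe_nnreal_ennreal
  have hms : MeasurableSet {p : X × X | dist p.1 p.2 ≤ (1 / 2) ^ k} :=
    (isClosed_le (by fun_prop) (by fun_prop)).measurableSet
  rw [prod_withDensity hfm hfm, withDensity_apply _ hms, ← lintegral_indicator hms]
  refine lintegral_mono fun p => ?_
  by_cases hp : dist p.1 p.2 ≤ (1 / 2) ^ k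
  · rw [indicator_of_mem (by exact hp), nearDiag_eq_one hp]
    push_cast
    simp
  · rw [indicator_of_notMem (by exact hp)]
    exact zero_le

theorem hausdorffMeasure_inter_iInter_ne_zero {P : ProbabilityMeasure X} {s t : ℝ} (hs : 0 < s)
    (hst : s < t) {S : ℕ → Set X} (hS : ∀ n, ∃ t' > t, FrostmanDense P t' (S n)) {K : Set X}
    {f : X → NNReal} (hK : IsCompact K) (hf : Continuous f) (hf0 : ∀ x ∉ K, f x = 0)
    (hpos : 0 < ∫⁻ x, f x ∂(P : Measure X)) : μH[s] (K ∩ ⋂ n, S n) ≠ 0 := by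
  choose t' ht' hS' using hS
  obtain ⟨a, b, ha, hb, hbt, hadm⟩ := exists_admissible hK hf hf0 hpos (ht' 0) (hS' 0)
  let St := {q : Set X × (X → NNReal) // Admissible P a b t q.1 q.2}
  have hstep : ∀ (n : ℕ) (q : St), ∃ q' : St, q'.1.1 ⊆ q.1.1 ∩ S n := by
    intro n q
    obtain ⟨K', f', h1, h2⟩ := q.2.exists_subset (ht' n) hb hbt (hS' n)
    exact ⟨⟨(K', f'), h1⟩, h2⟩
  choose next hnext using hstep
  let seq : ℕ → St := fun n => Nat.rec ⟨(K, f), hadm⟩ next n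
  have hseq : ∀ n, (seq (n + 1)).1.1 ⊆ (seq n).1.1 ∩ S n := fun n => hnext n (seq n)
  have hanti : Antitone fun n => (seq n).1.1 :=
    antitone_nat_of_succ_le fun n => (hseq n).trans inter_subset_left
  have hsub : ⋂ n, (seq n).1.1 ⊆ K ∩ ⋂ n, S n := by
    intro x hx
    rw [mem_iInter] at hx
    exact ⟨hx 0, mem_iInter.2 fun n => (hseq n (hx (n + 1))).2⟩
  have hat : a ≠ ∞ := hadm.mass.ne_top
  have hfin : ∀ n, IsFiniteMeasure
      ((P : Measure X).withDensity fun x => ((seq n).1.2 x : ℝ≥0∞)) := by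
    intro n
    obtain ⟨M, hM⟩ := exists_forall_le_of_eq_zero_off (seq n).2.isCompact (seq n).2.continuous
      (seq n).2.eq_zero
    refine isFiniteMeasure_withDensity (ne_of_lt ?_)
    calc _ ≤ ∫⁻ _, (M : ℝ≥0∞) ∂(P : Measure X) :=
          lintegral_mono fun x => ENNReal.coe_le_coe.2 (hM x)
      _ < ∞ := by simp
  have hmain := hausdorffMeasure_iInter_ne_zero hanti (fun n => (seq n).2.isCompact)
    (fun n => (P : Measure X).withDensity fun x => ((seq n).1.2 x : ℝ≥0∞)) ?_
    (ENNReal.toReal_pos ha.ne' hat) ?_ (ENNReal.toReal_nonneg (a := b)) hs hst ?_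
  · exact fun h0 => hmain (measure_mono_null hsub h0)
  · intro n
    have hms := (seq n).2.isCompact.isClosed.measurableSet.compl
    rw [withDensity_apply _ hms]
    refine (setLIntegral_congr_fun hms fun x hx => ?_).trans lintegral_zero
    rw [(seq n).2.eq_zero x hx, ENNReal.coe_zero]
  · intro n
    rw [measureReal_def]
    refine (ENNReal.toReal_le_toReal hat (measure_ne_top _ _)).2 ?_
    rw [withDensity_apply _ MeasurableSet.univ, setLIntegral_univ]
    exact (seq n).2.mass.le
  · intro n k
    rw [measureReal_def]
    have h1 := (pair_measure_le_pairEnergy P k (seq n).2.continuous).trans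
      ((seq n).2.energy k).le
    refine (ENNReal.toReal_mono (ENNReal.mul_ne_top hbt ENNReal.ofReal_ne_top) h1).trans_eq ?_
    rw [ENNReal.toReal_mul, ENNReal.toReal_ofReal (by positivity)]

end

theorem abs_le_natFloor_of_abs_le {m : ℤ} {x : ℝ} (h : |(m : ℝ)| ≤ x) : |m| ≤ (⌊x⌋₊ : ℤ) := by
  rw [← Int.natCast_natAbs]
  refine Int.ofNat_le.2 (Nat.le_floor ?_)
  rwa [Nat.cast_natAbs, Int.cast_abs]

theorem card_pairs_near_le {q q' : ℕ} (hq : q.Prime) (hq' : q'.Prime) (hne : q ≠ q') {R : ℝ}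
    (hR : 0 ≤ R) :
    (((Finset.Ico 1 q ×ˢ Finset.Ico 1 q').filter
      (fun p => |(p.1 : ℝ) / q - p.2 / q'| ≤ R)).card : ℝ) ≤ 2 * q * q' * R := by
  have hq0 : (0 : ℝ) < q := by exact_mod_cast hq.pos
  have hq0' : (0 : ℝ) < q' := by exact_mod_cast hq'.pos
  have hcop : IsCoprime (q : ℤ) q' :=
    Nat.isCoprime_iff_coprime.2 ((Nat.coprime_primes hq hq').2 hne)
  set M : ℕ := ⌊q * q' * R⌋₊ with hM
  have hMR : (M : ℝ) ≤ q * q' * R := Nat.floor_le (by positivity)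
  have hcard : ((Finset.Ico 1 q ×ˢ Finset.Ico 1 q').filter
      (fun p => |(p.1 : ℝ) / q - p.2 / q'| ≤ R)).card ≤
      ((Finset.Icc (-(M : ℤ)) M).erase 0).card := by
    refine Finset.card_le_card_of_injOn (fun p => (p.1 : ℤ) * q' - p.2 * q) ?_ ?_
    · rintro ⟨p, p'⟩ hp
      simp only [Finset.coe_filter, Finset.mem_product, Finset.mem_Ico, mem_ofPred_eq] at hp
      obtain ⟨⟨⟨h1, h2⟩, h3, h4⟩, h5⟩ := hp
      simp only [Finset.coe_erase, Finset.coe_Icc, Set.mem_sdiff, mem_Icc, mem_singleton_iff,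
        ← abs_le]
      constructor
      · have h6 : |(((p : ℤ) * q' - p' * q : ℤ) : ℝ)| ≤ q * q' * R := by
          have : (((p : ℤ) * q' - p' * q : ℤ) : ℝ) = (q * q') * ((p : ℝ) / q - p' / q') := by
            push_cast
            field_simp
          rw [this, abs_mul, abs_of_pos (by positivity)]
          exact mul_le_mul_of_nonneg_left h5 (by positivity)
        exact abs_le_natFloor_of_abs_le h6
      · intro h0
        have hdvd : (q : ℤ) ∣ p * q' := ⟨p', by linarith⟩
        have h7 : (q : ℤ) ∣ p := hcop.dvd_of_dvd_mul_right hdvd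
        exact absurd (Nat.le_of_dvd h1 (Int.natCast_dvd_natCast.1 h7)) (by omega)
    · rintro ⟨p, p'⟩ hp ⟨a, a'⟩ ha h
      simp only [Finset.coe_filter, Finset.mem_product, Finset.mem_Ico, mem_ofPred_eq] at hp ha
      simp only at h
      have hdvd : (q : ℤ) ∣ (p - a) * q' := ⟨p' - a', by linarith⟩
      have h7 : (q : ℤ) ∣ p - a := hcop.dvd_of_dvd_mul_right hdvd
      have h8 : (p : ℤ) - a = 0 := Int.eq_zero_of_abs_lt_dvd h7 (by rw [abs_lt]; omega)
      have h9 : p = a := by omega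
      subst h9
      have h10 : (p' : ℤ) * q = a' * q := by linarith
      have h11 : (p' : ℤ) = a' := mul_right_cancel₀ (by exact_mod_cast hq.ne_zero) h10
      simp only [Prod.mk.injEq, true_and]
      exact_mod_cast h11
  have hcard2 : ((Finset.Icc (-(M : ℤ)) M).erase 0).card = 2 * M := by
    rw [Finset.card_erase_of_mem (by simp), Int.card_Icc]
    omega
  rw [hcard2] at hcard
  have : (((Finset.Ico 1 q ×ˢ Finset.Ico 1 q').filter
      (fun p => |(p.1 : ℝ) / q - p.2 / q'| ≤ R)).card : ℝ) ≤ 2 * M := by exact_mod_cast hcard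
  linarith

theorem card_pairs_near_self_le {q : ℕ} (hq : 0 < q) {R : ℝ} (hR : 0 ≤ R) :
    (((Finset.Ico 1 q ×ˢ Finset.Ico 1 q).filter
      (fun p => |(p.1 : ℝ) / q - p.2 / q| ≤ R)).card : ℝ) ≤ (q - 1 : ℕ) * (1 + 2 * q * R) := by
  have hq0 : (0 : ℝ) < q := by exact_mod_cast hq
  set M : ℕ := ⌊q * R⌋₊ with hM
  have hMR : (M : ℝ) ≤ q * R := Nat.floor_le (by positivity)
  have hcard : ((Finset.Ico 1 q ×ˢ Finset.Ico 1 q).filter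
      (fun p => |(p.1 : ℝ) / q - p.2 / q| ≤ R)).card ≤
      (Finset.Ico 1 q ×ˢ Finset.Icc (-(M : ℤ)) M).card := by
    refine Finset.card_le_card_of_injOn (fun p => (p.1, (p.1 : ℤ) - p.2)) ?_ ?_
    · rintro ⟨p, p'⟩ hp
      simp only [Finset.coe_filter, Finset.mem_product, Finset.mem_Ico, mem_ofPred_eq] at hp
      obtain ⟨⟨h1, h3, h4⟩, h5⟩ := hp
      simp only [Finset.coe_product, Finset.coe_Icc, Finset.coe_Ico, mem_prod, mem_Icc, mem_Ico,
        ← abs_le]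
      refine ⟨h1, ?_⟩
      have h6 : |(((p : ℤ) - p' : ℤ) : ℝ)| ≤ q * R := by
        have : (((p : ℤ) - p' : ℤ) : ℝ) = q * ((p : ℝ) / q - p' / q) := by
          push_cast
          field_simp
        rw [this, abs_mul, abs_of_pos hq0]
        exact mul_le_mul_of_nonneg_left h5 hq0.le
      exact abs_le_natFloor_of_abs_le h6
    · rintro ⟨p, p'⟩ hp ⟨a, a'⟩ ha h
      simp only [Prod.mk.injEq] at h ⊢
      omega
  rw [Finset.card_product, Nat.card_Ico, Int.card_Icc] at hcard
  have h2 : ((M : ℤ) + 1 - -(M : ℤ)).toNat = 2 * M + 1 := by omega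
  rw [h2] at hcard
  calc _ ≤ (((q - 1) * (2 * M + 1) : ℕ) : ℝ) := by exact_mod_cast hcard
    _ = (q - 1 : ℕ) * (1 + 2 * (M : ℝ)) := by push_cast; ring
    _ ≤ _ := by
      refine mul_le_mul_of_nonneg_left ?_ (by positivity)
      linarith

/-- A continuous bump around `c` of radius `δ` and integral one. -/
def bump (c δ x : ℝ) : NNReal :=
  if h : 0 < δ then
    ((⟨δ / 2, δ, half_pos h, half_lt_self h⟩ : ContDiffBump c).normed volume x).toNNReal
  else 0

theorem continuous_bump (c δ : ℝ) : Continuous (bump c δ) := by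
  unfold bump
  split_ifs with h
  · exact continuous_real_toNNReal.comp (ContDiffBump.continuous_normed _)
  · exact continuous_const

theorem bump_le {c δ : ℝ} (hδ : 0 < δ) (x : ℝ) : (bump c δ x : ℝ≥0∞) ≤ ENNReal.ofReal (1 / δ) := by
  unfold bump
  rw [dif_pos hδ]
  refine ENNReal.ofReal_le_ofReal ((ContDiffBump.normed_le_div_measure_closedBall_rIn _ _ _).trans
    (le_of_eq ?_))
  rw [measureReal_def, Real.volume_closedBall, ENNReal.toReal_ofReal (by positivity)]
  congr 1
  ring

theorem bump_eq_zero {c δ x : ℝ} (hx : δ < |x - c|) : bump c δ x = 0 := by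
  unfold bump
  split_ifs with h
  · have : x ∉ Function.support
        ((⟨δ / 2, δ, half_pos h, half_lt_self h⟩ : ContDiffBump c).normed volume) := by
      rw [ContDiffBump.support_normed_eq, mem_ball, Real.dist_eq]
      exact not_lt.2 hx.le
    rw [Function.notMem_support.1 this, Real.toNNReal_zero]
  · rfl

theorem lintegral_bump {c δ : ℝ} (hδ : 0 < δ) : ∫⁻ x, bump c δ x = 1 := by
  unfold bump
  simp only [dif_pos hδ]
  refine (ofReal_integral_eq_lintegral_ofReal (ContDiffBump.integrable_normed _)
    (ae_of_all _ fun x => ContDiffBump.nonneg_normed _ x)).symm.trans ?_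
  rw [ContDiffBump.integral_normed, ENNReal.ofReal_one]

/-- Lebesgue measure on the unit interval. -/
def unitMeasure : Measure ℝ := volume.restrict (Icc 0 1)

instance : IsProbabilityMeasure unitMeasure := ⟨by simp [unitMeasure]⟩

/-- The measure with density `bump c δ`. -/
def bumpMeasure (c δ : ℝ) : Measure ℝ := unitMeasure.withDensity fun x => (bump c δ x : ℝ≥0∞)

theorem isProbabilityMeasure_bumpMeasure {c δ : ℝ} (hδ : 0 < δ) (h0 : 0 ≤ c - δ)
    (h1 : c + δ ≤ 1) : IsProbabilityMeasure (bumpMeasure c δ) := by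
  refine ⟨?_⟩
  rw [bumpMeasure, withDensity_apply _ MeasurableSet.univ, setLIntegral_univ, unitMeasure,
    ← lintegral_bump (c := c) hδ, ← lintegral_indicator measurableSet_Icc]
  refine lintegral_congr fun x => ?_
  by_cases hx : x ∈ Icc (0 : ℝ) 1
  · rw [indicator_of_mem hx]
  · rw [indicator_of_notMem hx, bump_eq_zero, ENNReal.coe_zero]
    rw [lt_abs]
    by_contra! h
    exact hx ⟨by linarith, by linarith⟩

theorem bumpMeasure_apply_le {c δ : ℝ} (hδ : 0 < δ) (s : Set ℝ) :
    bumpMeasure c δ s ≤ ENNReal.ofReal (1 / δ) * volume s := by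
  have h : bumpMeasure c δ ≤ ENNReal.ofReal (1 / δ) • (volume : Measure ℝ) := by
    refine Measure.le_iff.2 fun t ht => ?_
    rw [bumpMeasure, withDensity_apply _ ht, Measure.smul_apply, smul_eq_mul]
    refine (lintegral_mono fun x => bump_le hδ x).trans ?_
    rw [setLIntegral_const]
    exact mul_le_mul' le_rfl (Measure.restrict_apply_le _ _)
  simpa using h s

theorem ae_bumpMeasure (c δ : ℝ) : ∀ᵐ x ∂bumpMeasure c δ, |x - c| ≤ δ := by
  have hm : MeasurableSet {x : ℝ | δ < |x - c|} := measurableSet_lt (by fun_prop) (by fun_prop)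
  have : bumpMeasure c δ {x | δ < |x - c|} = 0 := by
    rw [bumpMeasure, withDensity_apply _ hm]
    refine (setLIntegral_congr_fun hm fun x hx => ?_).trans lintegral_zero
    rw [bump_eq_zero hx, ENNReal.coe_zero]
  rw [ae_iff]
  simpa using this

theorem bumpMeasure_prod_near_le {c c' δ δ' r : ℝ} (hδ' : 0 < δ')
    [IsProbabilityMeasure (bumpMeasure c δ)] [IsProbabilityMeasure (bumpMeasure c' δ')] :
    ((bumpMeasure c δ).prod (bumpMeasure c' δ')) {p | dist p.1 p.2 ≤ r} ≤
      if |c - c'| ≤ r + δ + δ' then ENNReal.ofReal (min 1 (2 * r / δ')) else 0 := by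
  have hm : MeasurableSet {p : ℝ × ℝ | dist p.1 p.2 ≤ r} :=
    (isClosed_le (by fun_prop) (by fun_prop)).measurableSet
  split_ifs with h
  · have hmin : ENNReal.ofReal (min 1 (2 * r / δ')) = min 1 (ENNReal.ofReal (2 * r / δ')) := by
      rw [(ENNReal.ofReal_mono).map_min, ENNReal.ofReal_one]
    rw [hmin]
    refine le_min prob_le_one ?_
    rw [Measure.prod_apply hm]
    calc _ ≤ ∫⁻ _, ENNReal.ofReal (2 * r / δ') ∂bumpMeasure c δ := by
          refine lintegral_mono fun x => (bumpMeasure_apply_le hδ' _).trans ?_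
          have : Prod.mk x ⁻¹' {p : ℝ × ℝ | dist p.1 p.2 ≤ r} = closedBall x r := by
            ext y; simp [dist_comm]
          rw [this, Real.volume_closedBall, ← ENNReal.ofReal_mul (by positivity)]
          apply le_of_eq
          congr 1
          ring
      _ = _ := by simp
  · rw [nonpos_iff_eq_zero, ← compl_compl {p : ℝ × ℝ | dist p.1 p.2 ≤ r}, ← mem_ae_iff]
    have h1 : ∀ᵐ p ∂(bumpMeasure c δ).prod (bumpMeasure c' δ'), |p.1 - c| ≤ δ :=
      Measure.quasiMeasurePreserving_fst.ae (ae_bumpMeasure c δ)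
    have h2 : ∀ᵐ p ∂(bumpMeasure c δ).prod (bumpMeasure c' δ'), |p.2 - c'| ≤ δ' :=
      Measure.quasiMeasurePreserving_snd.ae (ae_bumpMeasure c' δ')
    filter_upwards [h1, h2] with p hp1 hp2 hp
    apply h
    rw [mem_ofPred_eq, Real.dist_eq] at hp
    rw [abs_le] at *
    constructor <;> linarith

/-- The density of `ratMeasure q δ`. -/
def ratDensity (q : ℕ) (δ x : ℝ) : NNReal :=
  ((q - 1 : ℕ) : NNReal)⁻¹ * ∑ p ∈ Finset.Ico 1 q, bump (p / q) δ x

theorem continuous_ratDensity (q : ℕ) (δ : ℝ) : Continuous (ratDensity q δ) :=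
  continuous_const.mul (continuous_finsetSum _ fun _ _ => continuous_bump _ _)

/-- The uniform measure on the fractions `p / q`, `0 < p < q`, mollified at scale `δ`. -/
def ratMeasure (q : ℕ) (δ : ℝ) : Measure ℝ :=
  unitMeasure.withDensity fun x => (ratDensity q δ x : ℝ≥0∞)

theorem withDensity_finsetSum {α ι : Type*} [MeasurableSpace α] (μ : Measure α) (s : Finset ι)
    {f : ι → α → ℝ≥0∞} (hf : ∀ i, Measurable (f i)) :
    μ.withDensity (fun x => ∑ i ∈ s, f i x) = ∑ i ∈ s, μ.withDensity (f i) := by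
  ext t ht
  rw [withDensity_apply _ ht, lintegral_finsetSum _ (fun i _ => hf i), Measure.finsetSum_apply]
  exact Finset.sum_congr rfl fun i _ => (withDensity_apply _ ht).symm

theorem ratMeasure_eq (q : ℕ) (δ : ℝ) : ratMeasure q δ =
    ENNReal.ofReal ((q - 1 : ℕ) : ℝ)⁻¹ • ∑ p ∈ Finset.Ico 1 q, bumpMeasure (p / q) δ := by
  unfold bumpMeasure
  have hm : ∀ p : ℕ, Measurable fun x => (bump (p / q) δ x : ℝ≥0∞) := fun p =>
    (continuous_bump _ _).measurable.coe_nnreal_ennreal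
  rw [← withDensity_finsetSum _ _ hm, ← withDensity_smul _ (by fun_prop), ratMeasure]
  congr 1
  ext x
  have : ENNReal.ofReal ((q - 1 : ℕ) : ℝ)⁻¹ = (((q - 1 : ℕ) : NNReal)⁻¹ : NNReal) := by
    rw [← ENNReal.ofReal_coe_nnreal, NNReal.coe_inv, NNReal.coe_natCast]
  rw [Pi.smul_apply, this, ratDensity, smul_eq_mul]
  push_cast
  rfl

theorem isProbabilityMeasure_bumpMeasure_div {q p : ℕ} (hp : p ∈ Finset.Ico 1 q) {δ : ℝ}
    (hδ : 0 < δ) (hδq : δ ≤ 1 / q) : IsProbabilityMeasure (bumpMeasure (p / q) δ) := by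
  rw [Finset.mem_Ico] at hp
  have hq : (0 : ℝ) < q := by exact_mod_cast (by omega : 0 < q)
  have h1 : (1 : ℝ) ≤ p := by exact_mod_cast hp.1
  have h2 : (p : ℝ) + 1 ≤ q := by exact_mod_cast hp.2
  refine isProbabilityMeasure_bumpMeasure hδ ?_ ?_
  · have : (1 : ℝ) / q ≤ p / q := by gcongr
    linarith
  · have : (p : ℝ) / q + 1 / q ≤ 1 := by rw [← add_div, div_le_one hq]; exact h2
    linarith

theorem isProbabilityMeasure_ratMeasure {q : ℕ} (hq : 2 ≤ q) {δ : ℝ} (hδ : 0 < δ)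
    (hδq : δ ≤ 1 / q) : IsProbabilityMeasure (ratMeasure q δ) := by
  refine ⟨?_⟩
  rw [ratMeasure_eq, Measure.smul_apply, Measure.finsetSum_apply,
    Finset.sum_congr rfl fun p hp => (isProbabilityMeasure_bumpMeasure_div hp hδ hδq).measure_univ]
  have h : (0 : ℝ) < (q - 1 : ℕ) := by exact_mod_cast (by omega : 0 < q - 1)
  rw [Finset.sum_const, Nat.card_Ico, nsmul_one, smul_eq_mul, ← ENNReal.ofReal_natCast,
    ← ENNReal.ofReal_mul (by positivity), inv_mul_cancel₀ h.ne', ENNReal.ofReal_one]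

theorem ratMeasure_prod_near_le {q q' : ℕ} (hq : 2 ≤ q) (hq' : 2 ≤ q') {δ δ' r B : ℝ} (hδ : 0 < δ)
    (hδ' : 0 < δ') (hδq : δ ≤ 1 / q) (hδq' : δ' ≤ 1 / q') (hr : 0 < r)
    (hB : (((Finset.Ico 1 q ×ˢ Finset.Ico 1 q').filter
      (fun p => |(p.1 : ℝ) / q - p.2 / q'| ≤ r + δ + δ')).card : ℝ) ≤ B) :
    ((ratMeasure q δ).prod (ratMeasure q' δ')) {p | dist p.1 p.2 ≤ r} ≤
      ENNReal.ofReal (4 / (q * q') * B * min 1 (2 * r / δ')) := by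
  have hm : MeasurableSet {p : ℝ × ℝ | dist p.1 p.2 ≤ r} :=
    (isClosed_le (by fun_prop) (by fun_prop)).measurableSet
  have := isProbabilityMeasure_ratMeasure hq' hδ' hδq'
  have hmin0 : 0 ≤ min 1 (2 * r / δ') := le_min zero_le_one (by positivity)
  have hhalf : ∀ {n : ℕ}, 2 ≤ n → (((n - 1 : ℕ) : ℝ))⁻¹ ≤ 2 / n := by
    intro n hn
    have h2 : (2 : ℝ) ≤ n := by exact_mod_cast hn
    rw [Nat.cast_sub (by omega), Nat.cast_one, inv_eq_one_div, div_le_div_iff₀ (by linarith)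
      (by linarith)]
    linarith
  rw [Measure.prod_apply hm]
  rw [ratMeasure_eq]
  rw [lintegral_smul_measure, lintegral_finsetSum_measure]
  have hsum : ∀ p ∈ Finset.Ico 1 q,
      ∫⁻ x, ratMeasure q' δ' (Prod.mk x ⁻¹' {p | dist p.1 p.2 ≤ r}) ∂bumpMeasure (p / q) δ ≤
      ENNReal.ofReal ((q' - 1 : ℕ) : ℝ)⁻¹ * ∑ p' ∈ Finset.Ico 1 q',
        if |(p : ℝ) / q - p' / q'| ≤ r + δ + δ' then ENNReal.ofReal (min 1 (2 * r / δ')) else 0 := by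
    intro p hp
    have := isProbabilityMeasure_bumpMeasure_div hp hδ hδq
    rw [ratMeasure_eq]
    simp only [Measure.smul_apply, Measure.finsetSum_apply, smul_eq_mul]
    have hmeas : ∀ p' ∈ Finset.Ico 1 q', Measurable fun x =>
        bumpMeasure (p' / q') δ' (Prod.mk x ⁻¹' {p : ℝ × ℝ | dist p.1 p.2 ≤ r}) := by
      intro p' hp'
      have := isProbabilityMeasure_bumpMeasure_div hp' hδ' hδq'
      exact measurable_measure_prodMk_left hm
    rw [lintegral_const_mul _ (Finset.measurable_fun_sum _ hmeas), lintegral_finsetSum _ hmeas]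
    refine mul_le_mul' le_rfl (Finset.sum_le_sum fun p' hp' => ?_)
    have := isProbabilityMeasure_bumpMeasure_div hp' hδ' hδq'
    rw [← Measure.prod_apply hm]
    exact bumpMeasure_prod_near_le hδ'
  refine (mul_le_mul' le_rfl (Finset.sum_le_sum hsum)).trans ?_
  rw [← Finset.mul_sum, ← Finset.sum_product', ← Finset.sum_filter, Finset.sum_const,
    nsmul_eq_mul, ← ENNReal.ofReal_natCast, ← ENNReal.ofReal_mul (by positivity),
    ← ENNReal.ofReal_mul (by positivity), ← ENNReal.ofReal_mul (by positivity)]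
  refine ENNReal.ofReal_le_ofReal ?_
  calc _ ≤ 2 / (q : ℝ) * (2 / q' * (B * min 1 (2 * r / δ'))) := by
        gcongr
        · exact hhalf hq
        · exact hhalf hq'
    _ = _ := by ring

theorem ratMeasure_prod_near_le_of_ne {q q' : ℕ} (hq : q.Prime) (hq' : q'.Prime) (hne : q ≠ q')
    {δ δ' r C : ℝ} (hδ : 0 < δ) (hδ' : 0 < δ') (hδq : δ ≤ 1 / q) (hδq' : δ' ≤ 1 / q') (hr : 0 < r)
    (hC : δ ≤ C * δ') :
    ((ratMeasure q δ).prod (ratMeasure q' δ')) {p | dist p.1 p.2 ≤ r} ≤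
      ENNReal.ofReal (8 * (3 + 2 * C) * r) := by
  refine (ratMeasure_prod_near_le hq.two_le hq'.two_le hδ hδ' hδq hδq' hr
    (card_pairs_near_le hq hq' hne (by positivity))).trans (ENNReal.ofReal_le_ofReal ?_)
  have hq0 : (0 : ℝ) < q := by exact_mod_cast hq.pos
  have hq0' : (0 : ℝ) < q' := by exact_mod_cast hq'.pos
  have hC0 : 0 < C := pos_of_mul_pos_left (hδ.trans_le hC) hδ'.le
  have h1 : 4 / ((q : ℝ) * q') * (2 * q * q' * (r + δ + δ')) * min 1 (2 * r / δ') =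
      8 * (r * min 1 (2 * r / δ') + (δ + δ') * min 1 (2 * r / δ')) := by
    field_simp
    ring
  rw [h1]
  have h2 : r * min 1 (2 * r / δ') ≤ r * 1 := by gcongr; exact min_le_left _ _
  have h3 : (δ + δ') * min 1 (2 * r / δ') ≤ (C * δ' + δ') * (2 * r / δ') := by
    gcongr
    exact min_le_right _ _
  have h4 : (C * δ' + δ') * (2 * r / δ') = 2 * (C + 1) * r := by field_simp
  linarith

theorem ratMeasure_prod_near_self_le {q : ℕ} (hq : 2 ≤ q) {δ r : ℝ} (hδ : 0 < δ)
    (hδq : δ ≤ 1 / (2 * q)) (hr : 0 < r) :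
    ((ratMeasure q δ).prod (ratMeasure q δ)) {p | dist p.1 p.2 ≤ r} ≤
      ENNReal.ofReal (12 * (r + 1 / q * min 1 (2 * r / δ))) := by
  have hq0 : (0 : ℝ) < q := by exact_mod_cast (by omega : 0 < q)
  have hδq' : δ ≤ 1 / q := hδq.trans (by gcongr; linarith)
  refine (ratMeasure_prod_near_le hq hq hδ hδ hδq' hδq' hr
    (card_pairs_near_self_le (by omega) (by positivity))).trans (ENNReal.ofReal_le_ofReal ?_)
  have h1 : ((q - 1 : ℕ) : ℝ) ≤ q := by exact_mod_cast Nat.sub_le q 1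
  have hmin0 : 0 ≤ min 1 (2 * r / δ) := le_min zero_le_one (by positivity)
  have hδ1 : 2 * q * δ ≤ 1 := by
    rw [le_div_iff₀ (by positivity)] at hδq
    linarith
  calc 4 / ((q : ℝ) * q) * ((q - 1 : ℕ) * (1 + 2 * q * (r + δ + δ))) * min 1 (2 * r / δ)
      ≤ 4 / ((q : ℝ) * q) * (q * (1 + 2 * q * (r + δ + δ))) * min 1 (2 * r / δ) := by gcongr
    _ = 4 / q * (1 + 2 * (2 * q * δ)) * min 1 (2 * r / δ) + 8 * (r * min 1 (2 * r / δ)) := by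
        field_simp
        ring
    _ ≤ 4 / q * (1 + 2 * 1) * min 1 (2 * r / δ) + 8 * (r * 1) := by
        gcongr
        exact min_le_left _ _
    _ = 12 * (1 / q * min 1 (2 * r / δ)) + 8 * r := by ring
    _ ≤ _ := by linarith

theorem abs_integral_sub_le_of_ae_near {μ : Measure ℝ} [IsProbabilityMeasure μ]
    (F : BoundedContinuousFunction ℝ ℝ) {y ε : ℝ} (h : ∀ᵐ x ∂μ, |F x - y| ≤ ε) :
    |∫ x, F x ∂μ - y| ≤ ε := by
  have h1 : ∫ x, (F x - y) ∂μ = ∫ x, F x ∂μ - y := by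
    rw [integral_sub (F.integrable μ) (integrable_const _)]
    simp
  rw [← h1]
  simpa using norm_integral_le_of_norm_le_const (f := fun x => F x - y) h

theorem integral_unitMeasure_eq_sum (F : BoundedContinuousFunction ℝ ℝ) {q : ℕ} (hq : 0 < q) :
    ∫ x, F x ∂unitMeasure =
      ∑ p ∈ Finset.range q, ∫ x in (p / q : ℝ)..((p + 1 : ℕ) / q : ℝ), F x := by
  have hq0 : (q : ℝ) ≠ 0 := by exact_mod_cast hq.ne'
  rw [intervalIntegral.sum_integral_adjacent_intervals (a := fun p : ℕ => (p / q : ℝ))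
    (fun k _ => F.continuous.intervalIntegrable _ _), Nat.cast_zero, zero_div, div_self hq0,
    intervalIntegral.integral_of_le zero_le_one, unitMeasure, integral_Icc_eq_integral_Ioc]

theorem tendsto_integral_ratMeasure {δ : ℕ → ℝ} (hδ0 : ∀ q, 2 ≤ q → 0 < δ q)
    (hδ : ∀ q, 2 ≤ q → δ q ≤ 1 / q) (F : BoundedContinuousFunction ℝ ℝ) :
    Tendsto (fun q => ∫ x, F x ∂ratMeasure q (δ q)) atTop (𝓝 (∫ x, F x ∂unitMeasure)) := by
  rw [Metric.tendsto_atTop']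
  intro ε hε
  obtain ⟨η, hη, hF⟩ := Metric.uniformContinuousOn_iff.1
    (isCompact_Icc.uniformContinuousOn_of_continuous (s := Icc (0 : ℝ) 1) F.continuous.continuousOn)
    (ε / 4) (by positivity)
  obtain ⟨N₁, hN₁⟩ := exists_nat_gt (1 / η)
  obtain ⟨N₂, hN₂⟩ := exists_nat_gt (8 * ‖F‖ / ε)
  refine ⟨max 1 (max N₁ N₂), fun q hq => ?_⟩
  simp only [gt_iff_lt, max_lt_iff] at hq
  obtain ⟨hq1, hqN₁, hqN₂⟩ := hq
  have hq2 : 2 ≤ q := hq1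
  have hq0 : (0 : ℝ) < q := by exact_mod_cast (by omega : 0 < q)
  have hqc1 : ((q - 1 : ℕ) : ℝ) = q - 1 := by rw [Nat.cast_sub (by omega), Nat.cast_one]
  have hq10 : (0 : ℝ) < q - 1 := by
    have : (2 : ℝ) ≤ q := by exact_mod_cast hq2
    linarith
  have hqη : 1 / (q : ℝ) < η := by
    have : 1 / η < q := hN₁.trans (by exact_mod_cast hqN₁)
    exact (one_div_lt hη hq0).1 this
  have hqM : 2 * ‖F‖ / q < ε / 4 := by
    have : 8 * ‖F‖ / ε < q := hN₂.trans (by exact_mod_cast hqN₂)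
    rw [div_lt_iff₀ hε] at this
    rw [div_lt_iff₀ hq0]
    linarith
  have hnear : ∀ p : ℕ, p < q → ∀ x ∈ Icc (0 : ℝ) 1, |x - p / q| ≤ 1 / q →
      |F x - F (p / q)| ≤ ε / 4 := by
    intro p hp x hx hxp
    have hpq : (p / q : ℝ) ∈ Icc (0 : ℝ) 1 :=
      ⟨by positivity, by rw [div_le_one hq0]; exact_mod_cast hp.le⟩
    exact (hF x hx _ hpq (hxp.trans_lt hqη)).le
  have hA : ∀ p ∈ Finset.Ico 1 q, |∫ x, F x ∂bumpMeasure (p / q) (δ q) - F (p / q)| ≤ ε / 4 := by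
    intro p hp
    have := isProbabilityMeasure_bumpMeasure_div hp (hδ0 q hq2) (hδ q hq2)
    refine abs_integral_sub_le_of_ae_near F ?_
    have hae : ∀ᵐ x ∂bumpMeasure (p / q) (δ q), x ∈ Icc (0 : ℝ) 1 :=
      (withDensity_absolutelyContinuous _ _).ae_le (ae_restrict_mem measurableSet_Icc)
    filter_upwards [ae_bumpMeasure (p / q) (δ q), hae] with x hx hx'
    exact hnear p (Finset.mem_Ico.1 hp).2 x hx' (hx.trans (hδ q hq2))
  have hB : ∀ p ∈ Finset.range q, |(∫ x in (p / q : ℝ)..((p + 1 : ℕ) / q : ℝ), F x) -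
      1 / q * F (p / q)| ≤ ε / 4 * (1 / q) := by
    intro p hp
    have hp' : ((p + 1 : ℕ) : ℝ) / q = p / q + 1 / q := by push_cast; ring
    have hle : (p : ℝ) / q ≤ (p + 1 : ℕ) / q := by rw [hp']; simp
    have h1 : (∫ x in (p / q : ℝ)..((p + 1 : ℕ) / q : ℝ), F x) - 1 / q * F (p / q) =
        ∫ x in (p / q : ℝ)..((p + 1 : ℕ) / q : ℝ), (F x - F (p / q)) := by
      rw [intervalIntegral.integral_sub (F.continuous.intervalIntegrable _ _) (by simp),
        intervalIntegral.integral_const, hp', smul_eq_mul]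
      ring
    rw [h1]
    have h2 := intervalIntegral.norm_integral_le_of_norm_le_const
      (f := fun x => F x - F (p / q)) (C := ε / 4) (a := p / q) (b := (p + 1 : ℕ) / q) ?_
    · rwa [Real.norm_eq_abs, abs_of_nonneg (sub_nonneg.2 hle), hp', add_sub_cancel_left,
        ← hp'] at h2
    · intro x hx
      rw [uIoc_of_le hle, hp'] at hx
      have hp1 : (p : ℝ) / q + 1 / q ≤ 1 := by
        rw [← add_div, div_le_one hq0]
        exact_mod_cast Finset.mem_range.1 hp
      have hp0 : (0 : ℝ) ≤ p / q := by positivity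
      refine hnear p (Finset.mem_range.1 hp) x ⟨by linarith [hx.1], by linarith [hx.2]⟩ ?_
      rw [abs_le]
      constructor <;> linarith [hx.1, hx.2]
  have hI : ∫ x, F x ∂ratMeasure q (δ q) =
      (q - 1 : ℝ)⁻¹ * ∑ p ∈ Finset.Ico 1 q, ∫ x, F x ∂bumpMeasure (p / q) (δ q) := by
    rw [ratMeasure_eq, integral_smul_measure, integral_finsetSum_measure,
      ENNReal.toReal_ofReal (by positivity), hqc1, smul_eq_mul]
    intro p hp
    have := isProbabilityMeasure_bumpMeasure_div hp (hδ0 q hq2) (hδ q hq2)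
    exact F.integrable _
  set T : ℝ := ∑ p ∈ Finset.Ico 1 q, F (p / q) with hT
  have hTle : |T| ≤ (q - 1) * ‖F‖ := by
    calc |T| ≤ ∑ p ∈ Finset.Ico 1 q, |F (p / q)| := Finset.abs_sum_le_sum_abs _ _
      _ ≤ ∑ p ∈ Finset.Ico 1 q, ‖F‖ := Finset.sum_le_sum fun p _ => F.norm_coe_le_norm _
      _ = _ := by rw [Finset.sum_const, Nat.card_Ico, nsmul_eq_mul, hqc1]
  have e1 : |(q - 1 : ℝ)⁻¹ * ∑ p ∈ Finset.Ico 1 q, ∫ x, F x ∂bumpMeasure (p / q) (δ q) -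
      (q - 1 : ℝ)⁻¹ * T| ≤ ε / 4 := by
    rw [← mul_sub, hT, ← Finset.sum_sub_distrib, abs_mul, abs_of_pos (inv_pos.2 hq10)]
    calc _ ≤ (q - 1 : ℝ)⁻¹ * ∑ p ∈ Finset.Ico 1 q, ε / 4 := by
          refine mul_le_mul_of_nonneg_left ?_ (inv_pos.2 hq10).le
          exact (Finset.abs_sum_le_sum_abs _ _).trans (Finset.sum_le_sum hA)
      _ = ε / 4 := by
          rw [Finset.sum_const, Nat.card_Ico, nsmul_eq_mul, hqc1, ← mul_assoc,
            inv_mul_cancel₀ hq10.ne', one_mul]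
  have e2 : |∫ x, F x ∂unitMeasure - 1 / q * (F 0 + T)| ≤ ε / 4 := by
    have hsum : F 0 + T = ∑ p ∈ Finset.range q, F (p / q) := by
      rw [hT, Finset.range_eq_Ico, Finset.sum_eq_sum_Ico_succ_bot (by omega : 0 < q),
        Nat.cast_zero, zero_div]
    rw [hsum, integral_unitMeasure_eq_sum F (by omega : 0 < q), Finset.mul_sum,
      ← Finset.sum_sub_distrib]
    calc _ ≤ ∑ p ∈ Finset.range q, ε / 4 * (1 / (q : ℝ)) :=
          (Finset.abs_sum_le_sum_abs _ _).trans (Finset.sum_le_sum hB)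
      _ = ε / 4 := by
          rw [Finset.sum_const, Finset.card_range, nsmul_eq_mul]
          field_simp
  have e3 : |(q - 1 : ℝ)⁻¹ * T - 1 / q * (F 0 + T)| ≤ 2 * ‖F‖ / q := by
    have h1 : (q - 1 : ℝ)⁻¹ * T - 1 / q * (F 0 + T) = (T / (q - 1) - F 0) / q := by
      field_simp
      ring
    have h2 : |T / (q - 1 : ℝ)| ≤ ‖F‖ := by
      rw [abs_div, abs_of_pos hq10, div_le_iff₀ hq10]
      linarith
    have h3 : |F 0| ≤ ‖F‖ := F.norm_coe_le_norm 0
    rw [h1, abs_div, abs_of_pos hq0]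
    gcongr
    exact (abs_sub _ _).trans (by linarith)
  rw [hI, Real.dist_eq]
  rw [abs_lt]
  rw [abs_le] at e1 e2 e3
  constructor <;> linarith

theorem Dval_le {d : ℕ} (τ : Fin d → ℝ) (j : Fin d) : Dval d τ ≤
    ((d : ℝ) + 1 + ((j : ℕ) + 1) * τ j - ∑ i ∈ Finset.univ.filter (· ≤ j), τ i) / (1 + τ j) :=
  ciInf_le (Set.finite_range _).bddBelow j

theorem card_filter_le {d : ℕ} (j : Fin d) :
    ((Finset.univ.filter (· ≤ j)).card : ℝ) = (j : ℕ) + 1 := by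
  have : (Finset.univ.filter (· ≤ j)) = Finset.Iic j := by ext; simp
  rw [this, Fin.card_Iic]
  push_cast
  rfl

theorem mul_le_sum_max {d : ℕ} {τ : Fin d → ℝ} (hτ : ∀ i, 0 < τ i) {t ρ : ℝ} (ht0 : 0 < t)
    (htd : t ≤ d) (ht : t ≤ Dval d τ) :
    ρ * t ≤ d + 1 + ∑ i, max 0 (ρ - 1 - τ i) := by
  obtain ⟨j, hj1, hj2⟩ : ∃ j : Fin d, ((j : ℕ) : ℝ) ≤ t ∧ t ≤ (j : ℕ) + 1 := by
    have h1 : 0 < ⌈t⌉₊ := Nat.ceil_pos.2 ht0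
    have h2 : ⌈t⌉₊ ≤ d := Nat.ceil_le.2 htd
    have h3 := Nat.ceil_lt_add_one ht0.le
    have h4 := Nat.le_ceil t
    have h5 : ((⌈t⌉₊ - 1 : ℕ) : ℝ) + 1 = ⌈t⌉₊ := by
      rw [Nat.cast_sub h1]; simp
    refine ⟨⟨⌈t⌉₊ - 1, by omega⟩, ?_, ?_⟩ <;> simp only <;> linarith
  have hD := ht.trans (Dval_le τ j)
  rw [le_div_iff₀ (by linarith [hτ j])] at hD
  set S := ∑ i ∈ Finset.univ.filter (· ≤ j), τ i with hS
  rcases le_total (τ j) (ρ - 1) with h | h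
  · have hsum : (((j : ℕ) : ℝ) + 1) * (ρ - 1) - S ≤ ∑ i, max 0 (ρ - 1 - τ i) := by
      calc (((j : ℕ) : ℝ) + 1) * (ρ - 1) - S
          = ∑ i ∈ Finset.univ.filter (· ≤ j), (ρ - 1 - τ i) := by
            rw [Finset.sum_sub_distrib, Finset.sum_const, nsmul_eq_mul, card_filter_le]
        _ ≤ ∑ i ∈ Finset.univ.filter (· ≤ j), max 0 (ρ - 1 - τ i) :=
            Finset.sum_le_sum fun i _ => le_max_right _ _
        _ ≤ _ := Finset.sum_le_sum_of_subset_of_nonneg (Finset.subset_univ _)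
            fun i _ _ => le_max_left _ _
    nlinarith [mul_nonneg (sub_nonneg.2 hj2) (sub_nonneg.2 h)]
  · have hmem : j ∈ Finset.univ.filter (· ≤ j) := by simp
    have hsum : ((j : ℕ) : ℝ) * (ρ - 1) - (S - τ j) ≤ ∑ i, max 0 (ρ - 1 - τ i) := by
      calc ((j : ℕ) : ℝ) * (ρ - 1) - (S - τ j)
          = ∑ i ∈ (Finset.univ.filter (· ≤ j)).erase j, (ρ - 1 - τ i) := by
            rw [Finset.sum_erase_eq_sub hmem, Finset.sum_sub_distrib, Finset.sum_const,
              nsmul_eq_mul, card_filter_le]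
            ring
        _ ≤ ∑ i ∈ (Finset.univ.filter (· ≤ j)).erase j, max 0 (ρ - 1 - τ i) :=
            Finset.sum_le_sum fun i _ => le_max_right _ _
        _ ≤ _ := Finset.sum_le_sum_of_subset_of_nonneg (Finset.subset_univ _)
            fun i _ _ => le_max_left _ _
    nlinarith [mul_nonneg (sub_nonneg.2 hj1) (sub_nonneg.2 h)]

theorem rpow_neg_mul_prod_min_le {d : ℕ} {τ : Fin d → ℝ} (hτ : ∀ i, 0 < τ i) {t : ℝ}
    (ht0 : 0 < t) (htd : t ≤ d) (ht : t ≤ Dval d τ) {q r : ℝ} (hq : 1 < q) (hr : 0 < r) :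
    q ^ (-((d : ℝ) + 1)) * ∏ i, min 1 (r * q ^ (1 + τ i)) ≤ r ^ t := by
  have hq0 : 0 < q := by linarith
  obtain ⟨ρ, hρ⟩ : ∃ ρ : ℝ, r = q ^ (-ρ) :=
    ⟨-Real.logb q r, by rw [neg_neg, Real.rpow_logb hq0 hq.ne' hr]⟩
  have hmin : ∀ i, min 1 (r * q ^ (1 + τ i)) = q ^ (-max 0 (ρ - 1 - τ i)) := by
    intro i
    rw [hρ, ← Real.rpow_add hq0, ← Real.rpow_zero q,
      ← (Real.strictMono_rpow_of_base_gt_one hq).monotone.map_min]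
    congr 1
    rw [← min_neg_neg]
    congr 1 <;> ring
  simp_rw [hmin]
  rw [← Real.rpow_sum_of_pos hq0, ← Real.rpow_add hq0, hρ, ← Real.rpow_mul hq0.le,
    Finset.sum_neg_distrib]
  refine Real.rpow_le_rpow_of_exponent_le hq.le ?_
  linarith [mul_le_sum_max hτ ht0 htd ht (ρ := ρ)]

theorem Dval_le_natCast {d : ℕ} (hd : 0 < d) {τ : Fin d → ℝ} (hτ : ∀ i, 1 / (d : ℝ) ≤ τ i) :
    Dval d τ ≤ d := by
  have hd0 : (0 : ℝ) < d := by exact_mod_cast hd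
  refine (Dval_le τ ⟨0, hd⟩).trans ?_
  have hτ0 := hτ ⟨0, hd⟩
  rw [div_le_iff₀ hd0] at hτ0
  have hpos : 0 < τ ⟨0, hd⟩ := (one_div_pos.2 hd0).trans_le (hτ _)
  have hS : ∑ i ∈ Finset.univ.filter (· ≤ (⟨0, hd⟩ : Fin d)), τ i = τ ⟨0, hd⟩ := by
    have : Finset.univ.filter (· ≤ (⟨0, hd⟩ : Fin d)) = {⟨0, hd⟩} := by
      ext i; simp [Fin.ext_iff, Fin.le_def]
    rw [this, Finset.sum_singleton]
  rw [hS, div_le_iff₀ (by linarith)]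
  push_cast
  linarith

/-- The primes in `(N, 4 N]`. -/
def primesNear (N : ℕ) : Finset ℕ := (Finset.Ioc N (4 * N)).filter Nat.Prime

theorem primesNear_nonempty {N : ℕ} (hN : N ≠ 0) : (primesNear N).Nonempty := by
  obtain ⟨p, hp, h1, h2⟩ := Nat.exists_prime_lt_and_le_two_mul N hN
  exact ⟨p, Finset.mem_filter.2 ⟨Finset.mem_Ioc.2 ⟨h1, by omega⟩, hp⟩⟩

theorem theta_sub_theta_le (N : ℕ) :
    Chebyshev.theta ((4 * N : ℕ) : ℝ) - Chebyshev.theta N ≤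
      (primesNear N).card * Real.log ((4 * N : ℕ) : ℝ) := by
  have hsub : (Finset.Ioc 0 N).filter Nat.Prime ⊆ (Finset.Ioc 0 (4 * N)).filter Nat.Prime :=
    Finset.filter_subset_filter _ (Finset.Ioc_subset_Ioc_right (by omega))
  rw [Chebyshev.theta, Chebyshev.theta, Nat.floor_natCast, Nat.floor_natCast,
    ← Finset.sum_sdiff hsub, add_sub_cancel_right, ← nsmul_eq_mul]
  have heq : (Finset.Ioc 0 (4 * N)).filter Nat.Prime \ (Finset.Ioc 0 N).filter Nat.Prime =
      primesNear N := by
    ext p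
    simp only [primesNear, Finset.mem_sdiff, Finset.mem_filter, Finset.mem_Ioc, not_and]
    constructor
    · rintro ⟨⟨⟨h1, h2⟩, h3⟩, h4⟩
      refine ⟨⟨?_, h2⟩, h3⟩
      by_contra! h
      exact h4 ⟨h1, h⟩ h3
    · rintro ⟨⟨h1, h2⟩, h3⟩
      exact ⟨⟨⟨by omega, h2⟩, h3⟩, fun h => absurd h.2 (by omega)⟩
  rw [heq]
  refine Finset.sum_le_card_nsmul _ _ _ fun p hp => ?_
  obtain ⟨h1, h2⟩ := Finset.mem_filter.1 hp
  exact Real.log_le_log (by exact_mod_cast h2.pos) (by exact_mod_cast (Finset.mem_Ioc.1 h1).2)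

theorem eventually_rpow_le_card_primesNear {η : ℝ} (hη : 0 < η) :
    ∀ᶠ N : ℕ in atTop, ((4 * N : ℕ) : ℝ) ^ (1 - η) ≤ (primesNear N).card := by
  have hx : Tendsto (fun N : ℕ => ((4 * N : ℕ) : ℝ)) atTop atTop :=
    tendsto_natCast_atTop_atTop.comp (tendsto_id.const_mul_atTop' (by norm_num))
  have o1 : ∀ᶠ x : ℝ in atTop, Real.log x ≤ 1 / 32 * x ^ (1 / 2 : ℝ) := by
    have h := (isLittleO_log_rpow_atTop (show (0 : ℝ) < 1 / 2 by norm_num)).bound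
      (show (0 : ℝ) < 1 / 32 by norm_num)
    filter_upwards [h, eventually_ge_atTop 1] with x h1 h2
    rwa [Real.norm_of_nonneg (Real.log_nonneg h2), Real.norm_of_nonneg (by positivity)] at h1
  have o2 : ∀ᶠ x : ℝ in atTop, Real.log x ≤ 1 / 8 * x ^ η := by
    have h := (isLittleO_log_rpow_atTop hη).bound (show (0 : ℝ) < 1 / 8 by norm_num)
    filter_upwards [h, eventually_ge_atTop 1] with x h1 h2
    rwa [Real.norm_of_nonneg (Real.log_nonneg h2), Real.norm_of_nonneg (by positivity)] at h1
  filter_upwards [hx.eventually o1, hx.eventually o2, hx.eventually (eventually_ge_atTop 4)] with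
    N h1 h2 h4
  have hθ := theta_sub_theta_le N
  have hge := Chebyshev.theta_ge (4 * N)
  have hle := Chebyshev.theta_le_log4_mul_x (x := N) (by positivity)
  set x : ℝ := ((4 * N : ℕ) : ℝ) with hxdef
  have hNx : (N : ℝ) = x / 4 := by rw [hxdef]; push_cast; ring
  have hlog4 : Real.log 4 = 2 * Real.log 2 := by
    rw [show (4 : ℝ) = 2 ^ 2 by norm_num, Real.log_pow]; norm_num
  have hlog2 := Real.log_two_gt_d9
  have hx0 : 0 < x := by linarith
  have hlogx : 0 < Real.log x := Real.log_pos (by linarith)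
  have hlog1 : Real.log (x + 1) ≤ 2 * Real.log x := by
    rw [← Real.log_rpow hx0]
    refine Real.log_le_log (by linarith) ?_
    norm_num
    nlinarith
  have hsq : √x * Real.log x ≤ 1 / 32 * x := by
    calc √x * Real.log x ≤ √x * (1 / 32 * x ^ (1 / 2 : ℝ)) := by gcongr
      _ = 1 / 32 * (√x * √x) := by rw [Real.sqrt_eq_rpow]; ring
      _ = 1 / 32 * x := by rw [Real.mul_self_sqrt hx0.le]
  have hlogx' : Real.log x ≤ √x * Real.log x := by
    refine le_mul_of_one_le_left hlogx.le ?_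
    rw [Real.one_le_sqrt]
    linarith
  have hmain : x / 8 ≤ (primesNear N).card * Real.log x := by
    have hle' : Chebyshev.theta N ≤ 2 * Real.log 2 * (x / 4) := by rw [← hNx, ← hlog4]; exact hle
    have h7 : 0.69 * x ≤ Real.log 2 * x := mul_le_mul_of_nonneg_right (by linarith) hx0.le
    have h8 : √x * Real.log x ≤ 1 / 32 * x := hsq
    linarith
  have hpow : x ^ (1 - η) * x ^ η = x := by
    rw [← Real.rpow_add hx0]; simp
  have hc : (0 : ℝ) ≤ (primesNear N).card := by positivity
  have h5 : x / 8 ≤ (primesNear N).card * (1 / 8 * x ^ η) :=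
    hmain.trans (mul_le_mul_of_nonneg_left h2 hc)
  have h6 : x ^ (1 - η) * x ^ η ≤ (primesNear N).card * x ^ η := by rw [hpow]; linarith
  exact le_of_mul_le_mul_right h6 (by positivity)

theorem pi_withDensity {ι : Type*} [Fintype ι] {Ω : ι → Type*} [∀ i, MeasurableSpace (Ω i)]
    (μ : ∀ i, Measure (Ω i)) [∀ i, IsProbabilityMeasure (μ i)] {f : ∀ i, Ω i → ℝ≥0∞}
    (hf : ∀ i, Measurable (f i)) [∀ i, SigmaFinite ((μ i).withDensity (f i))] :
    Measure.pi (fun i => (μ i).withDensity (f i)) =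
      (Measure.pi μ).withDensity fun x => ∏ i, f i (x i) := by
  refine (Measure.pi_eq fun s hs => ?_)
  have hind : ProbabilityTheory.iIndepFun (fun i (ω : ∀ i, Ω i) => (s i).indicator (f i) (ω i)) (Measure.pi μ) :=
    ProbabilityTheory.iIndepFun_pi fun i => ((hf i).indicator (hs i)).aemeasurable
  have h := ProbabilityTheory.lintegral_prod_eq_prod_lintegral_of_indepFun Finset.univ _ hind
    fun i => ((hf i).indicator (hs i)).comp (measurable_pi_apply i)
  have hs' : MeasurableSet (univ.pi s) := MeasurableSet.univ_pi hs
  rw [withDensity_apply _ hs', ← lintegral_indicator hs']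
  calc ∫⁻ x, (univ.pi s).indicator (fun x => ∏ i, f i (x i)) x ∂Measure.pi μ
      = ∫⁻ x, ∏ i, (s i).indicator (f i) (x i) ∂Measure.pi μ := by
        refine lintegral_congr fun x => ?_
        by_cases hx : x ∈ univ.pi s
        · rw [indicator_of_mem hx]
          exact Finset.prod_congr rfl fun i _ => (indicator_of_mem (hx i (mem_univ i)) _).symm
        · rw [indicator_of_notMem hx]
          simp only [mem_univ_pi, not_forall] at hx
          obtain ⟨i, hi⟩ := hx
          exact (Finset.prod_eq_zero (Finset.mem_univ i) (indicator_of_notMem hi _)).symm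
    _ = ∏ i, ∫⁻ x, (s i).indicator (f i) (x i) ∂Measure.pi μ := h
    _ = ∏ i, (μ i).withDensity (f i) (s i) := by
        refine Finset.prod_congr rfl fun i _ => ?_
        rw [withDensity_apply _ (hs i), ← lintegral_indicator (hs i)]
        exact (measurePreserving_eval μ i).lintegral_comp ((hf i).indicator (hs i))

theorem pi_prod_pi_dist_le {ι : Type*} [Fintype ι] (μ ν : ι → Measure ℝ)
    [∀ i, IsProbabilityMeasure (μ i)] [∀ i, IsProbabilityMeasure (ν i)] {r : ℝ} (hr : 0 ≤ r) :
    ((Measure.pi μ).prod (Measure.pi ν)) {p | dist p.1 p.2 ≤ r} =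
      ∏ i, ((μ i).prod (ν i)) {p | dist p.1 p.2 ≤ r} := by
  have hm : MeasurableSet {p : (ι → ℝ) × (ι → ℝ) | dist p.1 p.2 ≤ r} :=
    (isClosed_le (by fun_prop) (by fun_prop)).measurableSet
  rw [← (measurePreserving_arrowProdEquivProdArrow ℝ ℝ ι μ ν).measure_preimage
    hm.nullMeasurableSet, ← Measure.pi_pi]
  congr 1
  ext p
  simp [dist_pi_le_iff hr, MeasurableEquiv.arrowProdEquivProdArrow]

section Average

variable {X : Type*} [MeasurableSpace X]

/-- The average of a finite family of probability measures. -/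
def averageMeasure (s : Finset ℕ) (μ : ℕ → ProbabilityMeasure X) : Measure X :=
  (s.card : ℝ≥0∞)⁻¹ • ∑ q ∈ s, (μ q : Measure X)

theorem isProbabilityMeasure_averageMeasure {s : Finset ℕ} (hs : s.Nonempty)
    (μ : ℕ → ProbabilityMeasure X) : IsProbabilityMeasure (averageMeasure s μ) := by
  refine ⟨?_⟩
  simp only [averageMeasure, Measure.smul_apply, Measure.finsetSum_apply, measure_univ,
    Finset.sum_const, nsmul_eq_mul, mul_one, smul_eq_mul]
  exact ENNReal.inv_mul_cancel (by simpa using hs.ne_empty) (ENNReal.natCast_ne_top _)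

theorem averageMeasure_eq_withDensity {s : Finset ℕ} (hs : s.Nonempty)
    {μ : ℕ → ProbabilityMeasure X} {P : Measure X} {g : ℕ → X → NNReal}
    (hg : ∀ q, Measurable (g q))
    (h : ∀ q ∈ s, (μ q : Measure X) = P.withDensity fun x => (g q x : ℝ≥0∞)) :
    averageMeasure s μ =
      P.withDensity fun x => (((s.card : NNReal)⁻¹ * ∑ q ∈ s, g q x : NNReal) : ℝ≥0∞) := by
  have hm : ∀ q, Measurable fun x => (g q x : ℝ≥0∞) := fun q => (hg q).coe_nnreal_ennreal
  rw [averageMeasure, Finset.sum_congr rfl h, ← withDensity_finsetSum _ _ hm,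
    ← withDensity_smul _ (by fun_prop)]
  congr 1
  ext x
  have hc : (s.card : NNReal) ≠ 0 := by simpa using hs.ne_empty
  simp [ENNReal.coe_inv hc]

theorem averageMeasure_prod_le {s : Finset ℕ} (hs : s.Nonempty)
    {μ : ℕ → ProbabilityMeasure X}
    {A : Set (X × X)} (hA : MeasurableSet A) {a b : ℝ≥0∞}
    (ha : ∀ q ∈ s, ∀ q' ∈ s, q ≠ q' → ((μ q : Measure X).prod (μ q')) A ≤ a)
    (hb : ∀ q ∈ s, ((μ q : Measure X).prod (μ q)) A ≤ b) :
    ((averageMeasure s μ).prod (averageMeasure s μ)) A ≤ a + (s.card : ℝ≥0∞)⁻¹ * b := by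
  have := isProbabilityMeasure_averageMeasure hs μ
  set c : ℝ≥0∞ := (s.card : ℝ≥0∞)⁻¹ with hcdef
  have hc : c * s.card = 1 :=
    ENNReal.inv_mul_cancel (by simpa using hs.ne_empty) (ENNReal.natCast_ne_top _)
  have hexp : ((averageMeasure s μ).prod (averageMeasure s μ)) A =
      c * ∑ q ∈ s, c * ∑ q' ∈ s, ((μ q : Measure X).prod (μ q')) A := by
    rw [Measure.prod_apply hA, averageMeasure, lintegral_smul_measure,
      lintegral_finsetSum_measure, smul_eq_mul]
    congr 1
    refine Finset.sum_congr rfl fun q _ => ?_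
    simp only [Measure.smul_apply, Measure.finsetSum_apply, smul_eq_mul]
    rw [lintegral_const_mul _ (Finset.measurable_fun_sum _ fun q' _ =>
      measurable_measure_prodMk_left hA), lintegral_finsetSum _ fun q' _ => measurable_measure_prodMk_left hA]
    congr 1
    exact Finset.sum_congr rfl fun q' _ => (Measure.prod_apply hA).symm
  rw [hexp]
  calc c * ∑ q ∈ s, c * ∑ q' ∈ s, ((μ q : Measure X).prod (μ q')) A
      ≤ c * ∑ q ∈ s, c * ∑ q' ∈ s, (a + if q = q' then b else 0) := by
        gcongr with q hq q' hq'
        split_ifs with h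
        · subst h
          exact (hb q hq).trans le_add_self
        · simpa using ha q hq q' hq' h
    _ = c * ∑ q ∈ s, (a + c * b) := by
        congr 1
        refine Finset.sum_congr rfl fun q hq => ?_
        rw [Finset.sum_add_distrib, Finset.sum_ite_eq, if_pos hq, Finset.sum_const, nsmul_eq_mul,
          mul_add, ← mul_assoc, hc, one_mul]
    _ = a + c * b := by
        rw [Finset.sum_const, nsmul_eq_mul, ← mul_assoc, hc, one_mul]

theorem tendsto_averageMeasure [TopologicalSpace X] [OpensMeasurableSpace X]
    {μ : ℕ → ProbabilityMeasure X} {P : ProbabilityMeasure X} (h : Tendsto μ atTop (𝓝 P))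
    {s : ℕ → Finset ℕ} (hs : ∀ n, (s n).Nonempty) (hsn : ∀ n, ∀ q ∈ s n, n ≤ q)
    {ν : ℕ → ProbabilityMeasure X} (hν : ∀ n, (ν n : Measure X) = averageMeasure (s n) μ) :
    Tendsto ν atTop (𝓝 P) := by
  rw [ProbabilityMeasure.tendsto_iff_forall_integral_tendsto] at h ⊢
  intro F
  have hF := h F
  rw [Metric.tendsto_atTop'] at hF ⊢
  intro ε hε
  obtain ⟨N, hN⟩ := hF ε hε
  refine ⟨N, fun n hn => ?_⟩
  have hc : (0 : ℝ) < (s n).card := by exact_mod_cast (hs n).card_pos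
  have heq : ∫ x, F x ∂(ν n : Measure X) =
      ((s n).card : ℝ)⁻¹ * ∑ q ∈ s n, ∫ x, F x ∂(μ q : Measure X) := by
    rw [hν, averageMeasure, integral_smul_measure, integral_finsetSum_measure fun q _ =>
      F.integrable _, smul_eq_mul]
    simp
  have heq' : ∫ x, F x ∂(P : Measure X) =
      ((s n).card : ℝ)⁻¹ * ∑ q ∈ s n, ∫ x, F x ∂(P : Measure X) := by
    rw [Finset.sum_const, nsmul_eq_mul, ← mul_assoc, inv_mul_cancel₀ hc.ne', one_mul]
  rw [heq, heq', Real.dist_eq, ← mul_sub, ← Finset.sum_sub_distrib, abs_mul,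
    abs_of_pos (inv_pos.2 hc), inv_mul_lt_iff₀ hc]
  refine (Finset.abs_sum_le_sum_abs _ _).trans_lt ?_
  refine (Finset.sum_lt_sum_of_nonempty (hs n) fun q hq =>
    hN q (hn.trans_le (hsn n q hq))).trans_eq ?_
  rw [Finset.sum_const, nsmul_eq_mul]

end Average

/-- The points of `ℝ^d` admitting a rational approximation with denominator larger than `M` and
exponents `1 + τ_i`. -/
def approxSet {d : ℕ} (τ : Fin d → ℝ) (M : ℕ) : Set (Fin d → ℝ) :=
  {x | ∃ q : ℕ, M < q ∧ ∀ i, ∃ p : ℤ, |x i - p / q| < (q : ℝ) ^ (-(1 + τ i))}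

/-- Half of the approximation radius `q ^ (-(1 + a))`. -/
def radius (a : ℝ) (q : ℕ) : ℝ := (q : ℝ) ^ (-(1 + a)) / 2

theorem radius_pos (a : ℝ) {q : ℕ} (hq : 2 ≤ q) : 0 < radius a q := by
  have : (0 : ℝ) < q := by exact_mod_cast (by omega : 0 < q)
  unfold radius; positivity

theorem radius_le {a : ℝ} (ha : 0 < a) {q : ℕ} (hq : 2 ≤ q) : radius a q ≤ 1 / (2 * q) := by
  have hq1 : (1 : ℝ) ≤ q := by exact_mod_cast (by omega : 1 ≤ q)
  have h : (q : ℝ) ^ (-(1 + a)) ≤ (q : ℝ) ^ (-1 : ℝ) :=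
    Real.rpow_le_rpow_of_exponent_le hq1 (by linarith)
  rw [Real.rpow_neg_one] at h
  unfold radius
  calc (q : ℝ) ^ (-(1 + a)) / 2 ≤ (q : ℝ)⁻¹ / 2 := by gcongr
    _ = 1 / (2 * q) := by field_simp

theorem radius_le' {a : ℝ} (ha : 0 < a) {q : ℕ} (hq : 2 ≤ q) : radius a q ≤ 1 / q := by
  have hq1 : (1 : ℝ) ≤ q := by exact_mod_cast (by omega : 1 ≤ q)
  exact (radius_le ha hq).trans (by gcongr; linarith)

theorem radius_le_mul {a : ℝ} (ha : 0 < a) {q q' : ℕ} (hq : 2 ≤ q) (hq' : 2 ≤ q')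
    (hqq : q' ≤ 4 * q) : radius a q ≤ 4 ^ (1 + a) * radius a q' := by
  have h0 : (0 : ℝ) < q := by exact_mod_cast (by omega : 0 < q)
  have h0' : (0 : ℝ) < q' := by exact_mod_cast (by omega : 0 < q')
  have h : (q' : ℝ) ^ (1 + a) ≤ (4 * q) ^ (1 + a) :=
    Real.rpow_le_rpow h0'.le (by exact_mod_cast hqq) (by linarith)
  rw [Real.mul_rpow (by norm_num) h0.le] at h
  unfold radius
  rw [Real.rpow_neg h0.le, Real.rpow_neg h0'.le, ← mul_div_assoc]
  gcongr
  rw [← div_eq_mul_inv, le_div_iff₀ (by positivity), inv_mul_le_iff₀ (by positivity), mul_comm]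
  exact h

/-- Lebesgue measure on the unit interval, as a probability measure. -/
def unitProb : ProbabilityMeasure ℝ := ⟨unitMeasure, inferInstance⟩

theorem toMeasure_unitProb : (unitProb : Measure ℝ) = unitMeasure := rfl

open Classical in
/-- `ratMeasure q δ` as a probability measure. -/
def ratProb (q : ℕ) (δ : ℝ) : ProbabilityMeasure ℝ :=
  if h : IsProbabilityMeasure (ratMeasure q δ) then
    (⟨ratMeasure q δ, h⟩ : ProbabilityMeasure ℝ)
  else unitProb

theorem toMeasure_ratProb {a : ℝ} (ha : 0 < a) {q : ℕ} (hq : 2 ≤ q) :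
    (ratProb q (radius a q) : Measure ℝ) = ratMeasure q (radius a q) := by
  have h : IsProbabilityMeasure (ratMeasure q (radius a q)) :=
    isProbabilityMeasure_ratMeasure hq (radius_pos a hq) (radius_le' ha hq)
  have h2 : ratProb q (radius a q) = (⟨ratMeasure q (radius a q), h⟩ : ProbabilityMeasure ℝ) :=
    dif_pos h
  rw [h2]
  rfl

/-- Lebesgue measure on the unit cube. -/
def cubeProb (d : ℕ) : ProbabilityMeasure (Fin d → ℝ) :=
  ProbabilityMeasure.pi fun _ => unitProb

/-- The product of the measures `ratMeasure q (radius (τ i) q)`. -/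
def boxProb {d : ℕ} (τ : Fin d → ℝ) (q : ℕ) : ProbabilityMeasure (Fin d → ℝ) :=
  ProbabilityMeasure.pi fun i => ratProb q (radius (τ i) q)

/-- The density of `boxProb τ q`. -/
def boxDensity {d : ℕ} (τ : Fin d → ℝ) (q : ℕ) (x : Fin d → ℝ) : NNReal :=
  ∏ i, ratDensity q (radius (τ i) q) (x i)

theorem continuous_boxDensity {d : ℕ} (τ : Fin d → ℝ) (q : ℕ) : Continuous (boxDensity τ q) :=
  continuous_finsetProd _ fun i _ => (continuous_ratDensity _ _).comp (continuous_apply i)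

theorem toMeasure_boxProb {d : ℕ} {τ : Fin d → ℝ} (hτ : ∀ i, 0 < τ i) {q : ℕ} (hq : 2 ≤ q) :
    (boxProb τ q : Measure (Fin d → ℝ)) =
      (cubeProb d : Measure (Fin d → ℝ)).withDensity fun x => (boxDensity τ q x : ℝ≥0∞) := by
  have : ∀ i, IsProbabilityMeasure (ratMeasure q (radius (τ i) q)) := fun i =>
    isProbabilityMeasure_ratMeasure hq (radius_pos _ hq) (radius_le' (hτ i) hq)
  unfold ratMeasure at this
  have h := pi_withDensity (fun _ : Fin d => unitMeasure)
    (f := fun i x => (ratDensity q (radius (τ i) q) x : ℝ≥0∞))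
    fun i => (continuous_ratDensity _ _).measurable.coe_nnreal_ennreal
  unfold boxProb cubeProb boxDensity
  simp only [ProbabilityMeasure.toMeasure_pi, toMeasure_ratProb (hτ _) hq, toMeasure_unitProb,
    ENNReal.ofNNReal_finsetProd]
  exact h

theorem tendsto_boxProb {d : ℕ} {τ : Fin d → ℝ} (hτ : ∀ i, 0 < τ i) :
    Tendsto (boxProb τ) atTop (𝓝 (cubeProb d)) := by
  unfold boxProb cubeProb
  refine (ProbabilityMeasure.continuous_pi.tendsto _).comp (tendsto_pi_nhds.2 fun i => ?_)
  rw [ProbabilityMeasure.tendsto_iff_forall_integral_tendsto]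
  intro F
  refine (tendsto_integral_ratMeasure (δ := radius (τ i)) (fun q hq => radius_pos _ hq)
    (fun q hq => radius_le' (hτ i) hq) F).congr' ?_
  filter_upwards [eventually_ge_atTop 2] with q hq
  simp only [toMeasure_ratProb (hτ i) hq]

theorem exists_abs_sub_le_of_ratDensity_ne_zero {q : ℕ} {δ x : ℝ} (h : ratDensity q δ x ≠ 0) :
    ∃ p ∈ Finset.Ico 1 q, |x - (p : ℕ) / q| ≤ δ := by
  by_contra! hcon
  refine h ?_
  unfold ratDensity
  rw [Finset.sum_eq_zero fun p hp => bump_eq_zero (hcon p hp), mul_zero]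

theorem exists_isClosed_boxDensity {d : ℕ} (τ : Fin d → ℝ) {q M : ℕ} (hq : 2 ≤ q) (hM : M < q) :
    ∃ F, IsClosed F ∧ F ⊆ approxSet τ M ∧ ∀ x ∉ F, boxDensity τ q x = 0 := by
  refine ⟨univ.pi fun i => ⋃ p ∈ Finset.Ico 1 q, {y : ℝ | |y - (p : ℕ) / q| ≤ radius (τ i) q},
    isClosed_set_pi fun i _ => Set.Finite.isClosed_biUnion (Finset.finite_toSet _) fun p _ =>
      isClosed_le (by fun_prop) (by fun_prop), fun x hx => ⟨q, hM, fun i => ?_⟩, fun x hx => ?_⟩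
  · have := hx i (mem_univ i)
    simp only [mem_iUnion] at this
    obtain ⟨p, -, hp⟩ := this
    refine ⟨p, ?_⟩
    have h0 := radius_pos (τ i) hq
    have h1 : radius (τ i) q < (q : ℝ) ^ (-(1 + τ i)) := by
      unfold radius at h0 ⊢; linarith
    rw [Int.cast_natCast]
    exact lt_of_le_of_lt hp h1
  · by_contra hne
    refine hx fun i _ => ?_
    have h := Finset.prod_ne_zero_iff.1 hne i (Finset.mem_univ i)
    obtain ⟨p, hp, hpx⟩ := exists_abs_sub_le_of_ratDensity_ne_zero h
    simp only [mem_iUnion]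
    exact ⟨p, hp, hpx⟩

theorem boxProb_prod_dist_le {d : ℕ} {τ : Fin d → ℝ} (hτ : ∀ i, 0 < τ i) {q q' : ℕ} (hq : 2 ≤ q)
    (hq' : 2 ≤ q') {r : ℝ} (hr : 0 ≤ r) :
    ((boxProb τ q : Measure (Fin d → ℝ)).prod (boxProb τ q')) {p | dist p.1 p.2 ≤ r} =
      ∏ i, ((ratMeasure q (radius (τ i) q)).prod (ratMeasure q' (radius (τ i) q')))
        {p | dist p.1 p.2 ≤ r} := by
  unfold boxProb
  rw [ProbabilityMeasure.toMeasure_pi, ProbabilityMeasure.toMeasure_pi, pi_prod_pi_dist_le _ _ hr]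
  exact Finset.prod_congr rfl fun i _ => by
    rw [toMeasure_ratProb (hτ i) hq, toMeasure_ratProb (hτ i) hq']

theorem boxProb_prod_near_le_of_ne {d : ℕ} {τ : Fin d → ℝ} (hτ : ∀ i, 0 < τ i) {q q' : ℕ}
    (hq : q.Prime) (hq' : q'.Prime) (hne : q ≠ q') (hqq : q' ≤ 4 * q) {r : ℝ} (hr : 0 < r) :
    ((boxProb τ q : Measure (Fin d → ℝ)).prod (boxProb τ q')) {p | dist p.1 p.2 ≤ r} ≤
      ENNReal.ofReal ((∏ i, 8 * (3 + 2 * (4 : ℝ) ^ (1 + τ i))) * r ^ d) := by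
  rw [boxProb_prod_dist_le hτ hq.two_le hq'.two_le hr.le]
  calc _ ≤ ∏ i, ENNReal.ofReal (8 * (3 + 2 * (4 : ℝ) ^ (1 + τ i)) * r) :=
        Finset.prod_le_prod' fun i _ => ratMeasure_prod_near_le_of_ne hq hq' hne
          (radius_pos _ hq.two_le) (radius_pos _ hq'.two_le) (radius_le' (hτ i) hq.two_le)
          (radius_le' (hτ i) hq'.two_le) hr (radius_le_mul (hτ i) hq.two_le hq'.two_le hqq)
    _ = _ := by
        rw [← ENNReal.ofReal_prod_of_nonneg fun i _ => by positivity, Finset.prod_mul_distrib,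
          Finset.prod_const, Finset.card_univ, Fintype.card_fin]

theorem boxProb_prod_near_self_le {d : ℕ} {τ : Fin d → ℝ} (hτ : ∀ i, 0 < τ i) {q : ℕ} (hq : 2 ≤ q)
    {r : ℝ} (hr : 0 < r) :
    ((boxProb τ q : Measure (Fin d → ℝ)).prod (boxProb τ q)) {p | dist p.1 p.2 ≤ r} ≤
      ENNReal.ofReal (∏ i, 48 * (r + (q : ℝ)⁻¹ * min 1 (r * (q : ℝ) ^ (1 + τ i)))) := by
  rw [boxProb_prod_dist_le hτ hq hq hr.le, ENNReal.ofReal_prod_of_nonneg fun i _ => by positivity]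
  refine Finset.prod_le_prod' fun i _ => (ratMeasure_prod_near_self_le hq (radius_pos _ hq)
    (radius_le (hτ i) hq) hr).trans (ENNReal.ofReal_le_ofReal ?_)
  have hq0 : (0 : ℝ) < q := by exact_mod_cast (by omega : 0 < q)
  have h1 : 2 * r / radius (τ i) q = 4 * (r * (q : ℝ) ^ (1 + τ i)) := by
    unfold radius
    rw [Real.rpow_neg hq0.le]
    field_simp
    norm_num
  have h2 : min 1 (2 * r / radius (τ i) q) ≤ 4 * min 1 (r * (q : ℝ) ^ (1 + τ i)) := by
    rw [h1, mul_min_of_nonneg _ _ (by norm_num : (0 : ℝ) ≤ 4)]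
    exact min_le_min (by norm_num) le_rfl
  have h3 : 1 / (q : ℝ) * min 1 (2 * r / radius (τ i) q) ≤
      (q : ℝ)⁻¹ * (4 * min 1 (r * (q : ℝ) ^ (1 + τ i))) := by
    rw [one_div]; gcongr
  linarith

theorem prod_near_self_le {d : ℕ} {τ : Fin d → ℝ} (hτ : ∀ i, 0 < τ i) {u η : ℝ} (hu : 0 < u)
    (hud : u ≤ d) (huD : u ≤ Dval d τ) (hη : 0 ≤ η) (hη1 : η ≤ 1) {q Q r : ℝ} (hq : 1 < q)
    (hqQ : q ≤ Q) (hr : 0 < r) :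
    ∏ i, 48 * (r + q⁻¹ * min 1 (r * q ^ (1 + τ i))) ≤
      96 ^ d * (r ^ d + Q ^ (1 - η) * r ^ (u - η)) := by
  have hq0 : 0 < q := by linarith
  have hQ0 : 0 < Q := by linarith
  rcases le_or_gt (1 / q) r with h | h
  · calc ∏ i, 48 * (r + q⁻¹ * min 1 (r * q ^ (1 + τ i))) ≤ ∏ _i : Fin d, 96 * r := by
          refine Finset.prod_le_prod (fun i _ => by positivity) fun i _ => ?_
          have : q⁻¹ * min 1 (r * q ^ (1 + τ i)) ≤ q⁻¹ * 1 := by gcongr; exact min_le_left _ _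
          rw [one_div] at h
          linarith
      _ = 96 ^ d * (r ^ d + 0) := by simp [mul_pow]
      _ ≤ _ := by gcongr; positivity
  · have hrq : r * q ≤ 1 := by rw [lt_div_iff₀ hq0] at h; exact h.le
    have h1 : ∏ i, 48 * (r + q⁻¹ * min 1 (r * q ^ (1 + τ i))) ≤
        ∏ i, (96 * q⁻¹) * min 1 (r * q ^ (1 + τ i)) := by
      refine Finset.prod_le_prod (fun i _ => by positivity) fun i _ => ?_
      have : r ≤ q⁻¹ * min 1 (r * q ^ (1 + τ i)) := by
        rw [inv_mul_eq_div, le_div_iff₀ hq0]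
        refine le_min hrq ?_
        gcongr
        calc q = q ^ (1 : ℝ) := (Real.rpow_one q).symm
          _ ≤ q ^ (1 + τ i) := Real.rpow_le_rpow_of_exponent_le hq.le (by linarith [hτ i])
      linarith
    have h2 := rpow_neg_mul_prod_min_le hτ hu hud huD hq hr
    have h3 : q ^ (-((d : ℝ) + 1)) = (q⁻¹) ^ d * q⁻¹ := by
      rw [Real.rpow_neg hq0.le, Real.rpow_add hq0, Real.rpow_one, Real.rpow_natCast, mul_inv,
        inv_pow]
    rw [h3] at h2
    have h4 : (q⁻¹) ^ d * ∏ i, min 1 (r * q ^ (1 + τ i)) ≤ q * r ^ u := by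
      rw [mul_right_comm, ← div_eq_mul_inv, div_le_iff₀ hq0] at h2
      linarith
    have h5 : q * r ^ u ≤ Q ^ (1 - η) * r ^ (u - η) := by
      calc q * r ^ u = q ^ (1 - η) * (q ^ η * r ^ η) * r ^ (u - η) := by
            have e1 : q = q ^ (1 - η) * q ^ η := by rw [← Real.rpow_add hq0]; simp
            have e2 : r ^ u = r ^ η * r ^ (u - η) := by rw [← Real.rpow_add hr]; simp
            rw [e2]
            nth_rewrite 1 [e1]
            ring
        _ ≤ Q ^ (1 - η) * 1 * r ^ (u - η) := by
            gcongr
            rw [← Real.mul_rpow hq0.le hr.le]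
            exact Real.rpow_le_one (by positivity) (by linarith) hη
        _ = _ := by ring
    calc _ ≤ _ := h1
      _ = 96 ^ d * ((q⁻¹) ^ d * ∏ i, min 1 (r * q ^ (1 + τ i))) := by
          rw [Finset.prod_mul_distrib, Finset.prod_const, Finset.card_univ, Fintype.card_fin,
            mul_pow, mul_assoc]
      _ ≤ 96 ^ d * (0 + Q ^ (1 - η) * r ^ (u - η)) := by
          gcongr
          linarith
      _ ≤ _ := by gcongr; positivity

theorem averageMeasure_boxProb_prod_near_le {d : ℕ} {τ : Fin d → ℝ} (hτ : ∀ i, 0 < τ i) {t η : ℝ}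
    (ht : 0 < t) (hη : 0 ≤ η) (hη1 : η ≤ 1) (hd : t + η ≤ d) (hD : t + η ≤ Dval d τ) {N : ℕ}
    (hN : N ≠ 0) (hcard : ((4 * N : ℕ) : ℝ) ^ (1 - η) ≤ (primesNear N).card) {r : ℝ} (hr : 0 < r)
    (hr2 : r ≤ 2) :
    ((averageMeasure (primesNear N) (boxProb τ)).prod
      (averageMeasure (primesNear N) (boxProb τ))) {p | dist p.1 p.2 ≤ r} ≤
      ENNReal.ofReal ((((∏ i, 8 * (3 + 2 * (4 : ℝ) ^ (1 + τ i))) + 96 ^ d) * 2 ^ (d - t) + 96 ^ d) *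
        r ^ t) := by
  have hne := primesNear_nonempty hN
  have hm : MeasurableSet {p : (Fin d → ℝ) × (Fin d → ℝ) | dist p.1 p.2 ≤ r} :=
    (isClosed_le (by fun_prop) (by fun_prop)).measurableSet
  have hmem : ∀ q ∈ primesNear N, N < q ∧ q ≤ 4 * N ∧ q.Prime := fun q hq => by
    obtain ⟨h1, h2⟩ := Finset.mem_filter.1 hq
    exact ⟨(Finset.mem_Ioc.1 h1).1, (Finset.mem_Ioc.1 h1).2, h2⟩
  set K : ℝ := ∏ i, 8 * (3 + 2 * (4 : ℝ) ^ (1 + τ i)) with hK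
  have hK0 : 0 ≤ K := Finset.prod_nonneg fun i _ => by positivity
  have hc1 : (1 : ℝ) ≤ (primesNear N).card := by exact_mod_cast hne.card_pos
  set c : ℝ := ((primesNear N).card : ℝ) with hc
  refine (averageMeasure_prod_le hne hm (a := ENNReal.ofReal (K * r ^ d))
    (b := ENNReal.ofReal (96 ^ d * (r ^ d + ((4 * N : ℕ) : ℝ) ^ (1 - η) * r ^ (t + η - η))))
    (fun q hq q' hq' hqq => ?_) fun q hq => ?_).trans ?_
  · have h1 := hmem q hq
    have h2 := hmem q' hq'
    exact boxProb_prod_near_le_of_ne hτ h1.2.2 h2.2.2 hqq (by omega) hr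
  · have h1 := hmem q hq
    refine (boxProb_prod_near_self_le hτ h1.2.2.two_le hr).trans (ENNReal.ofReal_le_ofReal ?_)
    exact prod_near_self_le hτ (by linarith) hd hD hη hη1 (by exact_mod_cast h1.2.2.one_lt)
      (by exact_mod_cast h1.2.1) hr
  · have hcinv : ((primesNear N).card : ℝ≥0∞)⁻¹ = ENNReal.ofReal c⁻¹ := by
      rw [ENNReal.ofReal_inv_of_pos (by linarith), hc, ENNReal.ofReal_natCast]
    rw [hcinv, ← ENNReal.ofReal_mul (by positivity),
      ← ENNReal.ofReal_add (by positivity) (by positivity)]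
    refine ENNReal.ofReal_le_ofReal ?_
    have hrd : r ^ d ≤ 2 ^ (d - t) * r ^ t := by
      rw [← Real.rpow_natCast, show (d : ℝ) = (d - t) + t by ring, Real.rpow_add hr,
        sub_add_cancel]
      gcongr
      linarith
    have h1 : c⁻¹ * (r ^ d) ≤ r ^ d :=
      mul_le_of_le_one_left (by positivity) (inv_le_one_of_one_le₀ hc1)
    have h2 : c⁻¹ * (((4 * N : ℕ) : ℝ) ^ (1 - η) * r ^ t) ≤ r ^ t := by
      rw [← mul_assoc]
      refine mul_le_of_le_one_left (by positivity) ?_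
      rw [inv_mul_le_iff₀ (by linarith), mul_one]
      exact hcard
    rw [add_sub_cancel_right]
    calc K * r ^ d + c⁻¹ * (96 ^ d * (r ^ d + ((4 * N : ℕ) : ℝ) ^ (1 - η) * r ^ t))
        = K * r ^ d + 96 ^ d * (c⁻¹ * r ^ d + c⁻¹ * (((4 * N : ℕ) : ℝ) ^ (1 - η) * r ^ t)) := by ring
      _ ≤ K * r ^ d + 96 ^ d * (r ^ d + r ^ t) := by gcongr
      _ = (K + 96 ^ d) * r ^ d + 96 ^ d * r ^ t := by ring
      _ ≤ (K + 96 ^ d) * (2 ^ (d - t) * r ^ t) + 96 ^ d * r ^ t := by gcongr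
      _ = _ := by ring

theorem frostmanDense_approxSet {d : ℕ} {τ : Fin d → ℝ} (hτ : ∀ i, 0 < τ i) {t : ℝ} (ht : 0 < t)
    (hd : Dval d τ ≤ d) (htD : t < Dval d τ) (M : ℕ) :
    FrostmanDense (cubeProb d) t (approxSet τ M) := by
  set η : ℝ := min 1 (Dval d τ - t) with hη
  have hη0 : 0 < η := lt_min one_pos (by linarith)
  have hη1 : η ≤ 1 := min_le_left _ _
  have hηD : t + η ≤ Dval d τ := by linarith [min_le_right 1 (Dval d τ - t)]
  have hne : ∀ n, (primesNear (n + 1 + M)).Nonempty := fun n => primesNear_nonempty (by omega)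
  have hmem : ∀ n, ∀ q ∈ primesNear (n + 1 + M), n + 1 + M < q := fun n q hq =>
    (Finset.mem_Ioc.1 (Finset.mem_filter.1 hq).1).1
  refine ⟨((∏ i, 8 * (3 + 2 * (4 : ℝ) ^ (1 + τ i))) + 96 ^ d) * 2 ^ (d - t) + 96 ^ d,
    fun n => ⟨averageMeasure (primesNear (n + 1 + M)) (boxProb τ),
    isProbabilityMeasure_averageMeasure (hne n) _⟩, fun n x =>
      ((primesNear (n + 1 + M)).card : NNReal)⁻¹ * ∑ q ∈ primesNear (n + 1 + M), boxDensity τ q x,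
    fun n => ?_, fun n => ?_, fun n => ?_, ?_, ?_⟩
  · exact continuous_const.mul (continuous_finsetSum _ fun q _ => continuous_boxDensity τ q)
  · exact averageMeasure_eq_withDensity (hne n) (fun q => (continuous_boxDensity τ q).measurable)
      fun q hq => toMeasure_boxProb hτ (by have := hmem n q hq; omega)
  · have : ∀ q ∈ primesNear (n + 1 + M), ∃ F, IsClosed F ∧ F ⊆ approxSet τ M ∧
        ∀ x ∉ F, boxDensity τ q x = 0 := fun q hq =>
      exists_isClosed_boxDensity τ (by have := hmem n q hq; omega) (by have := hmem n q hq; omega)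
    choose! F hF1 hF2 hF3 using this
    refine ⟨⋃ q ∈ primesNear (n + 1 + M), F q,
      Set.Finite.isClosed_biUnion (Finset.finite_toSet _) hF1, iUnion₂_subset hF2, fun x hx => ?_⟩
    simp only [mem_iUnion, not_exists] at hx
    exact mul_eq_zero_of_right _ (Finset.sum_eq_zero fun q hq => hF3 q hq x (hx q hq))
  · exact tendsto_averageMeasure (tendsto_boxProb hτ) hne
      (fun n q hq => by have := hmem n q hq; omega) fun n => rfl
  · have h := (tendsto_add_atTop_nat (1 + M)).eventually (eventually_rpow_le_card_primesNear hη0)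
    filter_upwards [h] with n hn r hr hr2
    rw [← add_assoc] at hn
    exact averageMeasure_boxProb_prod_near_le hτ ht hη0.le hη1 (hηD.trans hd) hηD (by omega) hn hr hr2

/-- The projection `ℝ^d → 𝕋^d`. -/
def torusMk {d : ℕ} (x : Fin d → ℝ) : Torus d := fun i => (x i : AddCircle (1 : ℝ))

theorem norm_coe_le_abs_sub (x : ℝ) (p : ℤ) : ‖(x : AddCircle (1 : ℝ))‖ ≤ |x - p| := by
  have := UnitAddCircle.norm_eq (x := x)
  rw [this]
  exact round_le x p

theorem lipschitzWith_torusMk (d : ℕ) : LipschitzWith 1 (torusMk (d := d)) := by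
  refine LipschitzWith.of_dist_le_mul fun x y => ?_
  rw [NNReal.coe_one, one_mul, dist_pi_le_iff dist_nonneg]
  intro i
  refine le_trans ?_ (dist_le_pi_dist x y i)
  have := norm_coe_le_abs_sub (x i - y i) 0
  rw [AddCircle.coe_sub, Int.cast_zero, sub_zero] at this
  rwa [torusMk, torusMk, dist_eq_norm, Real.dist_eq]

/-- The cube `[0, 1/2]^d`, on which the projection to the torus is isometric. -/
def halfCube (d : ℕ) : Set (Fin d → ℝ) := univ.pi fun _ => Icc 0 (1 / 2)

theorem isometry_torusMk_halfCube (d : ℕ) : Isometry fun x : halfCube d => torusMk (x : Fin d → ℝ) := by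
  refine Isometry.of_dist_eq fun x y => ?_
  have h : ∀ i, dist (torusMk (x : Fin d → ℝ) i) (torusMk (y : Fin d → ℝ) i) =
      dist ((x : Fin d → ℝ) i) ((y : Fin d → ℝ) i) := fun i => by
    obtain ⟨h1, h2⟩ := x.2 i (mem_univ i)
    obtain ⟨h3, h4⟩ := y.2 i (mem_univ i)
    rw [torusMk, torusMk, dist_eq_norm, Real.dist_eq, ← AddCircle.coe_sub,
      AddCircle.norm_coe_eq_abs_iff (1 : ℝ) one_ne_zero, abs_one, abs_le]
    constructor <;> linarith
  have h' : ∀ i, nndist (torusMk (x : Fin d → ℝ) i) (torusMk (y : Fin d → ℝ) i) =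
      nndist ((x : Fin d → ℝ) i) ((y : Fin d → ℝ) i) := fun i => NNReal.eq (h i)
  rw [Subtype.dist_eq, dist_pi_def, dist_pi_def]
  simp only [h']

theorem dimH_image_torusMk {d : ℕ} {E : Set (Fin d → ℝ)} (hE : E ⊆ halfCube d) :
    dimH (torusMk '' E) = dimH E := by
  have h1 := (isometry_torusMk_halfCube d).dimH_image (Subtype.val ⁻¹' E)
  have h2 := (isometry_subtype_coe (s := halfCube d)).dimH_image (Subtype.val ⁻¹' E)
  have h3 : (Subtype.val : halfCube d → Fin d → ℝ) '' (Subtype.val ⁻¹' E) = E := by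
    rw [Subtype.image_preimage_coe, inter_eq_right.2 hE]
  have h4 : (fun x : halfCube d => torusMk (x : Fin d → ℝ)) '' (Subtype.val ⁻¹' E) =
      torusMk '' E := by
    rw [← image_image torusMk Subtype.val, h3]
  rw [h3] at h2
  rw [h4] at h1
  rw [h1, h2]

theorem torusMk_mem_Wset {d : ℕ} {τ : Fin d → ℝ} {x : Fin d → ℝ} (hx : ∀ M, x ∈ approxSet τ M) :
    torusMk x ∈ Wset d τ := by
  refine Set.infinite_of_forall_exists_gt fun M => ?_
  obtain ⟨q, hMq, hq⟩ := hx M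
  have hq0 : 0 < q := by omega
  have hq0' : (0 : ℝ) < q := by exact_mod_cast hq0
  refine ⟨q, ⟨hq0, fun i => ?_⟩, hMq⟩
  obtain ⟨p, hp⟩ := hq i
  have h1 : ‖q • torusMk x i‖ ≤ |q * x i - p| := by
    have := norm_coe_le_abs_sub (q * x i) p
    rwa [← nsmul_eq_mul, AddCircle.coe_nsmul, nsmul_eq_mul] at this
  have h2 : |q * x i - p| = q * |x i - p / q| := by
    rw [← abs_of_pos hq0', ← abs_mul, abs_of_pos hq0', mul_sub, mul_div_cancel₀ _ hq0'.ne']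
  calc (q : ℝ) ^ (τ i) * ‖q • torusMk x i‖ ≤ (q : ℝ) ^ (τ i) * (q * |x i - p / q|) := by
        rw [← h2]; gcongr
    _ < (q : ℝ) ^ (τ i) * (q * (q : ℝ) ^ (-(1 + τ i))) := by gcongr
    _ = 1 := by
        nth_rewrite 2 [← Real.rpow_one (q : ℝ)]
        rw [← Real.rpow_add hq0', ← Real.rpow_add hq0', ← Real.rpow_zero (q : ℝ)]
        congr 1
        ring

theorem exists_continuous_halfCube (d : ℕ) : ∃ f : (Fin d → ℝ) → NNReal, Continuous f ∧
    (∀ x ∉ halfCube d, f x = 0) ∧ 0 < ∫⁻ x, f x ∂(cubeProb d : Measure (Fin d → ℝ)) := by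
  have hc : Continuous fun x : Fin d → ℝ => ∏ i, (x i * (1 / 2 - x i)).toNNReal := by fun_prop
  refine ⟨_, hc, fun x hx => ?_, ?_⟩
  · simp only [halfCube, mem_univ_pi, not_forall] at hx
    obtain ⟨i, hi⟩ := hx
    refine Finset.prod_eq_zero (Finset.mem_univ i) (Real.toNNReal_of_nonpos ?_)
    rw [mem_Icc, not_and_or, not_le, not_le] at hi
    rcases hi with hi | hi <;> nlinarith
  · rw [lintegral_pos_iff_support hc.measurable.coe_nnreal_ennreal]
    refine lt_of_lt_of_le ?_ (measure_mono (s := univ.pi fun _ => Ioo (0 : ℝ) (1 / 2)) ?_)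
    · rw [cubeProb, ProbabilityMeasure.toMeasure_pi, Measure.pi_pi, toMeasure_unitProb,
        CanonicallyOrderedAdd.prod_pos]
      intro i _
      rw [unitMeasure, Measure.restrict_apply measurableSet_Ioo, inter_eq_left.2]
      · simp
      · exact fun y hy => ⟨hy.1.le, hy.2.le.trans (by norm_num)⟩
    · intro x hx
      rw [Function.mem_support]
      norm_cast
      refine Finset.prod_ne_zero_iff.2 fun i _ => ?_
      obtain ⟨h1, h2⟩ := hx i (mem_univ i)
      exact (Real.toNNReal_pos.2 (mul_pos h1 (by linarith))).ne'

theorem iInf_Dval_le_dimH {d : ℕ} (hd : 0 < d) {T : Set (Fin d → ℝ)} (hTcount : T.Countable)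
    (hTne : T.Nonempty) (hτlow : ∀ τ ∈ T, ∀ i, 1 / (d : ℝ) ≤ τ i) :
    ⨅ τ ∈ T, ENNReal.ofReal (Dval d τ) ≤ dimH (⋂ τ ∈ T, Wset d τ) := by
  refine le_of_forall_lt_imp_le_of_dense fun c hc => ?_
  obtain ⟨s, hcs, hs⟩ := ENNReal.lt_iff_exists_nnreal_btwn.1 hc
  obtain ⟨t, hst, ht⟩ := ENNReal.lt_iff_exists_nnreal_btwn.1 hs
  have hst' : (s : ℝ) < t := by exact_mod_cast hst
  have hs0 : (0 : ℝ) < s := by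
    have : (0 : ℝ≥0∞) < s := pos_of_gt hcs
    exact_mod_cast this
  have hD : ∀ τ ∈ T, (t : ℝ) < Dval d τ := fun τ hτ => by
    have := ht.trans_le (iInf₂_le τ hτ)
    rw [← ENNReal.ofReal_coe_nnreal] at this
    exact (ENNReal.ofReal_lt_ofReal_iff_of_nonneg t.2).1 this
  obtain ⟨e, he⟩ := hTcount.exists_eq_range hTne
  have heT : ∀ n, e n ∈ T := fun n => he ▸ mem_range_self n
  have hpos : (0 : ℝ) < 1 / d := one_div_pos.2 (by exact_mod_cast hd)
  obtain ⟨f, hf, hf0, hfpos⟩ := exists_continuous_halfCube d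
  have hK : IsCompact (halfCube d) := isCompact_univ_pi fun _ => isCompact_Icc
  have hne := hausdorffMeasure_inter_iInter_ne_zero (P := cubeProb d) hs0 hst'
    (S := fun n => approxSet (e n.unpair.1) n.unpair.2) (fun n => by
      have h := hD _ (heT n.unpair.1)
      obtain ⟨t', h1, h2⟩ := exists_between h
      exact ⟨t', h1, frostmanDense_approxSet (fun i => hpos.trans_le (hτlow _ (heT _) i))
        (hs0.trans (hst'.trans h1)) (Dval_le_natCast hd (hτlow _ (heT _))) h2 _⟩) hK hf hf0 hfpos
  set E := halfCube d ∩ ⋂ n : ℕ, approxSet (e n.unpair.1) n.unpair.2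
  have h1 : (s : ℝ≥0∞) ≤ dimH E := le_dimH_of_hausdorffMeasure_ne_zero hne
  have h2 : torusMk '' E ⊆ ⋂ τ ∈ T, Wset d τ := by
    rintro _ ⟨x, hx, rfl⟩
    refine mem_iInter₂.2 fun τ hτ => torusMk_mem_Wset fun M => ?_
    obtain ⟨n, rfl⟩ : ∃ n, e n = τ := by rwa [he] at hτ
    have := mem_iInter.1 hx.2 (Nat.pair n M)
    rwa [Nat.unpair_pair] at this
  calc c ≤ s := hcs.le
    _ ≤ dimH E := h1
    _ = dimH (torusMk '' E) := (dimH_image_torusMk inter_subset_left).symm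
    _ ≤ _ := dimH_mono h2

theorem hausdorffMeasure_eq_zero_of_summable {X : Type*} [MetricSpace X] [MeasurableSpace X]
    [BorelSpace X] {s : Set X} {t : ℝ} (ht : 0 ≤ t) {ι : ℕ → Type*} [∀ k, Fintype (ι k)]
    {ρ : ℕ → ℝ} (hρ0 : ∀ k, 0 ≤ ρ k) (hρ : Antitone ρ) (hρlim : Tendsto ρ atTop (𝓝 0))
    (U : ∀ k, ι k → Set X) (hU : ∀ k i, ediam (U k i) ≤ ENNReal.ofReal (ρ k))
    (hs : ∀ x ∈ s, ∀ n, ∃ k, n ≤ k ∧ ∃ i, x ∈ U k i)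
    (hsum : Summable fun k => (Fintype.card (ι k) : ℝ) * ρ k ^ t) : μH[t] s = 0 := by
  have hlim : Tendsto (fun n => ENNReal.ofReal (ρ n)) atTop (𝓝 0) := by
    simpa using ENNReal.tendsto_ofReal hρlim
  have hle := Measure.hausdorffMeasure_le_liminf_tsum (l := atTop) (ι := fun n => Σ k, ι (k + n)) t s
    (fun n => ENNReal.ofReal (ρ n)) hlim (fun n i => U (i.1 + n) i.2)
    (Eventually.of_forall fun n i => (hU _ _).trans
      (ENNReal.ofReal_le_ofReal (hρ (Nat.le_add_left n i.1))))
    (Eventually.of_forall fun n x hx => by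
      obtain ⟨k, hnk, i, hi⟩ := hs x hx n
      obtain ⟨m, rfl⟩ := Nat.exists_eq_add_of_le' hnk
      exact mem_iUnion.2 ⟨⟨m, i⟩, hi⟩)
  set f : ℕ → ℝ≥0∞ := fun k => ENNReal.ofReal ((Fintype.card (ι k) : ℝ) * ρ k ^ t) with hf
  have hf0 : Tendsto (fun n => ∑' k, f (k + n)) atTop (𝓝 0) :=
    ENNReal.tendsto_sum_nat_add f hsum.tsum_ofReal_ne_top
  have hle2 : ∀ n, ∑' i : Σ k, ι (k + n), ediam (U (i.1 + n) i.2) ^ t ≤ ∑' k, f (k + n) := by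
    intro n
    rw [ENNReal.tsum_sigma' fun i : Σ k, ι (k + n) => ediam (U (i.1 + n) i.2) ^ t]
    refine ENNReal.tsum_le_tsum fun k => ?_
    rw [tsum_fintype]
    calc ∑ i, ediam (U (k + n) i) ^ t ≤ ∑ _i : ι (k + n), ENNReal.ofReal (ρ (k + n)) ^ t := by
          gcongr with i
          exact hU _ _
      _ = f (k + n) := by
          rw [Finset.sum_const, Finset.card_univ, nsmul_eq_mul]
          simp only [hf]
          rw [ENNReal.ofReal_mul (by positivity), ENNReal.ofReal_natCast,
            ENNReal.ofReal_rpow_of_nonneg (hρ0 _) ht]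
  refine le_antisymm (hle.trans ?_) zero_le
  rw [← hf0.liminf_eq]
  exact liminf_le_liminf (Eventually.of_forall hle2)

theorem sum_max_eq {d : ℕ} {τ : Fin d → ℝ} (hτ : Monotone τ) (j : Fin d) :
    ∑ i, max 0 (τ j - τ i) = ((j : ℕ) + 1) * τ j - ∑ i ∈ Finset.univ.filter (· ≤ j), τ i := by
  rw [← card_filter_le j, ← nsmul_eq_mul, ← Finset.sum_const, ← Finset.sum_sub_distrib,
    Finset.sum_filter]
  refine Finset.sum_congr rfl fun i _ => ?_
  split_ifs with h
  · exact max_eq_right (by linarith [hτ h])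
  · exact max_eq_left (by linarith [hτ (not_le.1 h).le])

theorem exists_mem_subinterval {x c w ρ : ℝ} (hw : |x - c| < w) (hρ : 0 < ρ) :
    ∃ m < ⌈w / ρ⌉₊, x ∈ Icc (c - w + 2 * m * ρ) (c - w + 2 * m * ρ + 2 * ρ) := by
  obtain ⟨h1, h2⟩ := abs_lt.1 hw
  have h0 : 0 ≤ (x - c + w) / (2 * ρ) := by
    have : 0 < x - c + w := by linarith
    positivity
  have h3 := Nat.floor_le h0
  have h4 := Nat.lt_floor_add_one ((x - c + w) / (2 * ρ))
  rw [le_div_iff₀ (by positivity)] at h3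
  rw [div_lt_iff₀ (by positivity)] at h4
  refine ⟨⌊(x - c + w) / (2 * ρ)⌋₊, ?_, by constructor <;> linarith⟩
  rw [Nat.lt_ceil, lt_div_iff₀ hρ]
  linarith

theorem exists_nat_abs_sub_lt {q : ℕ} (hq : 0 < q) {x a : ℝ} (hx0 : 0 ≤ x) (hx1 : x ≤ 1)
    (h : (q : ℝ) ^ a * ‖q • (x : AddCircle (1 : ℝ))‖ < 1) :
    ∃ p < q + 1, |x - (p : ℕ) / q| < (q : ℝ) ^ (-(1 + a)) := by
  have hq0 : (0 : ℝ) < q := by exact_mod_cast hq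
  have hqx0 : 0 ≤ q * x := by positivity
  have hqx1 : q * x ≤ q := by nlinarith
  have hr0 : 0 ≤ round (q * x) := by
    rw [round_eq]; exact Int.floor_nonneg.2 (by linarith)
  obtain ⟨p, hp⟩ := Int.eq_ofNat_of_zero_le hr0
  have hpq : p < q + 1 := by
    have : round ((q : ℝ) * x) ≤ q := by
      rw [round_eq, ← Int.lt_add_one_iff, Int.floor_lt]
      push_cast
      linarith
    omega
  refine ⟨p, hpq, ?_⟩
  have hn : ‖q • (x : AddCircle (1 : ℝ))‖ = |q * x - p| := by
    rw [← AddCircle.coe_nsmul, nsmul_eq_mul, UnitAddCircle.norm_eq, hp, Int.cast_natCast]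
  have h2 : |q * x - p| = q * |x - p / q| := by
    rw [← abs_of_pos hq0, ← abs_mul, abs_of_pos hq0, mul_sub, mul_div_cancel₀ _ hq0.ne']
  rw [hn, h2, ← mul_assoc, ← Real.rpow_add_one hq0.ne', add_comm] at h
  rwa [Real.rpow_neg hq0.le, ← one_div, lt_div_iff₀' (by positivity)]

theorem summable_card_mul_rpow {d : ℕ} {τ : Fin d → ℝ} (j : Fin d) {t : ℝ}
    (ht : (d : ℝ) + 1 + ∑ i, max 0 (τ j - τ i) < t * (1 + τ j)) :
    Summable fun k : ℕ => (Fintype.card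
      ((i : Fin d) → Fin (k + 1 + 1) × Fin ⌈((k + 1 : ℕ) : ℝ) ^ (τ j - τ i)⌉₊) : ℝ) *
        (2 * ((k + 1 : ℕ) : ℝ) ^ (-(1 + τ j))) ^ t := by
  set S := ∑ i, max 0 (τ j - τ i) with hS
  have hsum : Summable fun k : ℕ => 4 ^ d * 2 ^ t *
      ((k + 1 : ℕ) : ℝ) ^ ((d : ℝ) + S - t * (1 + τ j)) := by
    refine Summable.mul_left _ ?_
    exact (summable_nat_add_iff 1).2 (Real.summable_nat_rpow.2 (by linarith))
  refine Summable.of_nonneg_of_le (fun k => by positivity) (fun k => ?_) hsum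
  have hq1 : (1 : ℝ) ≤ ((k + 1 : ℕ) : ℝ) := by exact_mod_cast Nat.le_add_left 1 k
  have hq0 : (0 : ℝ) < ((k + 1 : ℕ) : ℝ) := by linarith
  simp only [Fintype.card_pi, Fintype.card_prod, Fintype.card_fin, Nat.cast_prod, Nat.cast_mul]
  set q : ℝ := ((k + 1 : ℕ) : ℝ) with hq
  have hcard : ∏ i, (((k + 1 + 1 : ℕ) : ℝ) * (⌈q ^ (τ j - τ i)⌉₊ : ℝ)) ≤
      ∏ i, (4 * (q * q ^ (max 0 (τ j - τ i)))) := by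
    refine Finset.prod_le_prod (fun i _ => by positivity) fun i _ => ?_
    have h1 : ((k + 1 + 1 : ℕ) : ℝ) ≤ 2 * q := by
      rw [Nat.cast_add (k + 1) 1, ← hq, Nat.cast_one]
      linarith
    have h2 : (⌈q ^ (τ j - τ i)⌉₊ : ℝ) ≤ 2 * q ^ (max 0 (τ j - τ i)) := by
      have h3 := (Nat.ceil_lt_add_one (by positivity : 0 ≤ q ^ (τ j - τ i))).le
      have h4 : q ^ (τ j - τ i) ≤ q ^ (max 0 (τ j - τ i)) :=
        Real.rpow_le_rpow_of_exponent_le hq1 (le_max_right _ _)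
      have h5 : 1 ≤ q ^ (max 0 (τ j - τ i)) := Real.one_le_rpow hq1 (le_max_left _ _)
      linarith
    calc _ ≤ (2 * q) * (2 * q ^ (max 0 (τ j - τ i))) := by gcongr
      _ = _ := by ring
  calc _ ≤ (∏ i, (4 * (q * q ^ (max 0 (τ j - τ i))))) * (2 * q ^ (-(1 + τ j))) ^ t := by gcongr
    _ = 4 ^ d * 2 ^ t * (q ^ d * q ^ S * q ^ (-(1 + τ j) * t)) := by
        rw [Finset.prod_mul_distrib, Finset.prod_mul_distrib, Finset.prod_const,
          Finset.prod_const, Finset.card_univ, Fintype.card_fin, hS,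
          Real.rpow_sum_of_pos hq0, Real.mul_rpow (by norm_num) (by positivity),
          ← Real.rpow_mul hq0.le]
        ring
    _ = _ := by
        rw [← Real.rpow_natCast q d, ← Real.rpow_add hq0, ← Real.rpow_add hq0]
        congr 2
        ring

theorem dimH_Wset_le {d : ℕ} {τ : Fin d → ℝ} (hmono : Monotone τ) (hτ : ∀ i, 0 < τ i) (j : Fin d) :
    dimH (Wset d τ) ≤ ENNReal.ofReal (((d : ℝ) + 1 + ((j : ℕ) + 1) * τ j -
      ∑ i ∈ Finset.univ.filter (· ≤ j), τ i) / (1 + τ j)) := by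
  set W : Set (Fin d → ℝ) := {x | (∀ i, x i ∈ Icc (0 : ℝ) 1) ∧ torusMk x ∈ Wset d τ} with hW
  have hsub : Wset d τ ⊆ torusMk '' W := by
    intro y hy
    have : ∀ i, ∃ x ∈ Icc (0 : ℝ) 1, (x : AddCircle (1 : ℝ)) = y i := fun i => by
      obtain ⟨x, hx, hxy⟩ := (AddCircle.eq_coe_Ico (y i))
      exact ⟨x, Ico_subset_Icc_self hx, hxy⟩
    choose x hx hxy using this
    have hxy' : torusMk x = y := funext hxy
    exact ⟨x, ⟨hx, hxy' ▸ hy⟩, hxy'⟩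
  refine (dimH_mono hsub).trans (((lipschitzWith_torusMk d).dimH_image_le W).trans
    (dimH_le fun t ht => ?_))
  by_contra! hlt
  have hτj : 0 < 1 + τ j := by linarith [hτ j]
  rw [← ENNReal.ofReal_coe_nnreal, ENNReal.ofReal_lt_ofReal_iff', div_lt_iff₀ hτj] at hlt
  have hexp : (d : ℝ) + 1 + ∑ i, max 0 (τ j - τ i) < t * (1 + τ j) := by
    rw [sum_max_eq hmono]; linarith [hlt.1]
  refine ENNReal.top_ne_zero (ht.symm.trans ?_)
  have hq0 : ∀ k : ℕ, (0 : ℝ) < ((k + 1 : ℕ) : ℝ) := fun k => by positivity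
  refine hausdorffMeasure_eq_zero_of_summable t.2
    (ι := fun k => (i : Fin d) → Fin (k + 1 + 1) × Fin ⌈((k + 1 : ℕ) : ℝ) ^ (τ j - τ i)⌉₊)
    (ρ := fun k => 2 * ((k + 1 : ℕ) : ℝ) ^ (-(1 + τ j))) (fun k => by positivity)
    (fun k l hkl => ?_) ?_ (fun k a => univ.pi fun i =>
      Icc (((a i).1 : ℕ) / ((k + 1 : ℕ) : ℝ) - ((k + 1 : ℕ) : ℝ) ^ (-(1 + τ i)) +
          2 * ((a i).2 : ℕ) * ((k + 1 : ℕ) : ℝ) ^ (-(1 + τ j)))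
        (((a i).1 : ℕ) / ((k + 1 : ℕ) : ℝ) - ((k + 1 : ℕ) : ℝ) ^ (-(1 + τ i)) +
          2 * ((a i).2 : ℕ) * ((k + 1 : ℕ) : ℝ) ^ (-(1 + τ j)) +
            2 * ((k + 1 : ℕ) : ℝ) ^ (-(1 + τ j))))
    (fun k a => ediam_pi_le_of_le fun i => ?_) (fun x hx n => ?_)
    (summable_card_mul_rpow j hexp)
  · have : (((k + 1 : ℕ) : ℝ)) ≤ ((l + 1 : ℕ) : ℝ) := by exact_mod_cast Nat.add_le_add_right hkl 1
    exact mul_le_mul_of_nonneg_left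
      (Real.rpow_le_rpow_of_nonpos (hq0 k) this (by linarith)) (by norm_num)
  · have h := (tendsto_rpow_neg_atTop hτj).comp
      (tendsto_natCast_atTop_atTop.comp (tendsto_add_atTop_nat 1))
    simpa using h.const_mul 2
  · rw [Real.ediam_Icc]
    exact ENNReal.ofReal_le_ofReal (by linarith)
  · obtain ⟨hx01, hxW⟩ := hx
    obtain ⟨q, ⟨hq, hqx⟩, hnq⟩ := hxW.exists_gt n
    obtain ⟨k, rfl⟩ : ∃ k, q = k + 1 := ⟨q - 1, by omega⟩
    refine ⟨k, by omega, ?_⟩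
    have h1 : ∀ i, ∃ a : Fin (k + 1 + 1) × Fin ⌈((k + 1 : ℕ) : ℝ) ^ (τ j - τ i)⌉₊, x i ∈
        Icc ((a.1 : ℕ) / ((k + 1 : ℕ) : ℝ) - ((k + 1 : ℕ) : ℝ) ^ (-(1 + τ i)) +
            2 * (a.2 : ℕ) * ((k + 1 : ℕ) : ℝ) ^ (-(1 + τ j)))
          ((a.1 : ℕ) / ((k + 1 : ℕ) : ℝ) - ((k + 1 : ℕ) : ℝ) ^ (-(1 + τ i)) +
            2 * (a.2 : ℕ) * ((k + 1 : ℕ) : ℝ) ^ (-(1 + τ j)) +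
              2 * ((k + 1 : ℕ) : ℝ) ^ (-(1 + τ j))) := fun i => by
      obtain ⟨p, hp, hpx⟩ := exists_nat_abs_sub_lt hq (hx01 i).1 (hx01 i).2 (hqx i)
      obtain ⟨m, hm, hmx⟩ := exists_mem_subinterval hpx
        (by positivity : 0 < ((k + 1 : ℕ) : ℝ) ^ (-(1 + τ j)))
      rw [← Real.rpow_sub (hq0 k), show -(1 + τ i) - -(1 + τ j) = τ j - τ i by ring] at hm
      exact ⟨(⟨p, hp⟩, ⟨m, hm⟩), hmx⟩
    choose a ha using h1
    exact ⟨a, fun i _ => ha i⟩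

theorem dimH_Wset_le_Dval {d : ℕ} (hd : 0 < d) {τ : Fin d → ℝ} (hmono : Monotone τ)
    (hτ : ∀ i, 0 < τ i) : dimH (Wset d τ) ≤ ENNReal.ofReal (Dval d τ) := by
  have : Nonempty (Fin d) := ⟨⟨0, hd⟩⟩
  obtain ⟨j, hj⟩ := exists_eq_ciInf_of_finite (f := fun j : Fin d =>
    ((d : ℝ) + 1 + ((j : ℕ) + 1) * τ j - ∑ i ∈ Finset.univ.filter (· ≤ j), τ i) / (1 + τ j))
  rw [Dval, ← hj]
  exact dimH_Wset_le hmono hτ j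

/-- **Example: dimension of countable intersections of the sets `W(τ)`.** If `T` is a
nonempty, at most countable set of vectors `τ` with `1/d ≤ τ_1 ≤ … ≤ τ_d`, then
`dim_H ⋂_{τ ∈ T} W(τ) = inf_{τ ∈ T} D(τ)`. -/
theorem dimH_iInter_Wset
    (d : ℕ) (hd : 0 < d) (T : Set (Fin d → ℝ))
    (hTcount : T.Countable) (hTne : T.Nonempty)
    (hτmono : ∀ τ ∈ T, Monotone τ) (hτlow : ∀ τ ∈ T, ∀ i, 1 / (d : ℝ) ≤ τ i) :
    dimH (⋂ τ ∈ T, Wset d τ) = ⨅ τ ∈ T, ENNReal.ofReal (Dval d τ) := by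
  have hpos : (0 : ℝ) < 1 / d := one_div_pos.2 (by exact_mod_cast hd)
  refine le_antisymm (le_iInf₂ fun τ hτ => ?_) (iInf_Dval_le_dimH hd hTcount hTne hτlow)
  exact (dimH_mono (biInter_subset_of_mem hτ)).trans
    (dimH_Wset_le_Dval hd (hτmono τ hτ) fun i => hpos.trans_le (hτlow τ hτ i))
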